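/- arXiv:0705.1663 — 7 statements merged into one kernel-verified Lean document; each statement's English description precedes it below -/
import Mathlib

section
/- For every affine-linear polynomial Q(x₁,x₂,x₃,x₄) with complex coefficients, one has the identity δ_{x₃}(δ_{x₁,x₂}(Q)) = δ_{x₂}(δ_{x₁,x₃}(Q)) of polynomials (both sides are polynomials of degree at most 4 in the single variable x₄). -/
open MvPolynomial

/-- `δ_{x_i,x_j}(Q) = Q_{x_i} Q_{x_j} - Q Q_{x_i x_j}`. -/
noncomputable def dd (i j : Fin 4) (Q : MvPolynomial (Fin 4) ℂ) : MvPolynomial (Fin 4) ℂ :=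
  pderiv i Q * pderiv j Q - Q * pderiv i (pderiv j Q)

/-- `δ_{x_i}(h) = h_{x_i}^2 - 2 h h_{x_i x_i}`. -/
noncomputable def ds (i : Fin 4) (h : MvPolynomial (Fin 4) ℂ) : MvPolynomial (Fin 4) ℂ :=
  (pderiv i h) ^ 2 - 2 * h * pderiv i (pderiv i h)

theorem pderiv_pderiv_comm {σ R : Type*} [CommRing R] (i j : σ) (p : MvPolynomial σ R) :
    pderiv i (pderiv j p) = pderiv j (pderiv i p) := by
  classical
  have h : ⁅pderiv (R := R) i, pderiv (R := R) j⁆ = 0 := by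
    ext k : 1
    simp [Derivation.commutator_apply, pderiv_X, Pi.single_apply, apply_ite]
  have := DFunLike.congr_fun h p
  rwa [Derivation.commutator_apply, Derivation.zero_apply, sub_eq_zero] at this

theorem pderiv_pderiv_eq_zero_of_degreeOf_le_one {σ R : Type*} [CommSemiring R] {i : σ}
    {p : MvPolynomial σ R} (hp : p.degreeOf i ≤ 1) : pderiv i (pderiv i p) = 0 := by
  rw [p.as_sum, map_sum, map_sum]
  refine Finset.sum_eq_zero fun m hm => ?_
  have h : m i ≤ 1 := (monomial_le_degreeOf i hm).trans hp
  have hm_sub : m i - 1 = 0 := by omega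
  simp [hm_sub]

/-- For affine-linear `Q(x₁,x₂,x₃,x₄)` (variables indexed `0,1,2,3`),
`δ_{x₃}(δ_{x₁,x₂}(Q)) = δ_{x₂}(δ_{x₁,x₃}(Q))`. -/
theorem statement0 (Q : MvPolynomial (Fin 4) ℂ) (hQ : ∀ i, Q.degreeOf i ≤ 1) :
    ds 2 (dd 0 1 Q) = ds 1 (dd 0 2 Q) := by
  have h1 := pderiv_pderiv_eq_zero_of_degreeOf_le_one (hQ 1)
  have h2 := pderiv_pderiv_eq_zero_of_degreeOf_le_one (hQ 2)
  have c10 := pderiv_pderiv_comm (R := ℂ) (1 : Fin 4) 0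
  have c20 := pderiv_pderiv_comm (R := ℂ) (2 : Fin 4) 0
  have c21 := pderiv_pderiv_comm (R := ℂ) (2 : Fin 4) 1
  have h112 : pderiv 1 (pderiv 1 (pderiv 2 Q)) = 0 := by
    rw [← c21, ← c21, h1, map_zero]
  simp only [ds, dd, map_sub, map_add, Derivation.leibniz, smul_eq_mul, c10, c20, c21, h1, h2,
    h112, map_zero]
  ring
end

section
/- Let Q(x₁,x₂,x₃,x₄) be an affine-linear polynomial with complex coefficients and set h^{ij} := δ_{x_k,x_l}(Q) for {i,j,k,l} = {1,2,3,4}. Then h^{12} h^{34} − h^{14} h^{23} = P·Q, where P := det [[Q, Q_{x₁}, Q_{x₃}], [Q_{x₂}, Q_{x₁x₂}, Q_{x₂x₃}], [Q_{x₄}, Q_{x₁x₄}, Q_{x₃x₄}]] (P is again affine-linear in each variable). -/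
open MvPolynomial

/-- Identity (2.9) of the paper: with `h^{ij} := δ_{x_k,x_l}(Q)` (so `h^{12} = dd 2 3 Q`,
`h^{34} = dd 0 1 Q`, `h^{14} = dd 1 2 Q`, `h^{23} = dd 0 3 Q`, variables indexed `0,1,2,3`),
`h^{12} h^{34} - h^{14} h^{23} = P·Q` with
`P = det [[Q, Q_{x₁}, Q_{x₃}], [Q_{x₂}, Q_{x₁x₂}, Q_{x₂x₃}], [Q_{x₄}, Q_{x₁x₄}, Q_{x₃x₄}]]`. -/
theorem statement4 (Q : MvPolynomial (Fin 4) ℂ) (hQ : ∀ i, Q.degreeOf i ≤ 1) :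
    dd 2 3 Q * dd 0 1 Q - dd 1 2 Q * dd 0 3 Q =
      Matrix.det
        !![Q, pderiv 0 Q, pderiv 2 Q;
           pderiv 1 Q, pderiv 0 (pderiv 1 Q), pderiv 1 (pderiv 2 Q);
           pderiv 3 Q, pderiv 0 (pderiv 3 Q), pderiv 2 (pderiv 3 Q)] * Q := by
  simp only [dd, Matrix.det_fin_three, Matrix.of_apply, Matrix.cons_val]
  ring
end

section
/- Let Q(x₁,x₂,x₃,x₄) be an affine-linear polynomial with complex coefficients and set h^{ij} := δ_{x_k,x_l}(Q) for {i,j,k,l} = {1,2,3,4}. Then the polynomial identity 2 Q_{x₁} · (h^{12} h^{34} − h^{14} h^{23}) = Q · (h^{12}_{x₁} h^{34} − h^{14}_{x₁} h^{23} + h^{23} h^{34}_{x₃} − h^{23}_{x₃} h^{34}) holds in ℂ[x₁,x₂,x₃,x₄]. -/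
open MvPolynomial

/-- Identity (2.10) of the paper (cleared of denominators): with
`h^{ij} := δ_{x_k,x_l}(Q)` (so `h^{12} = dd 2 3 Q`, `h^{34} = dd 0 1 Q`, `h^{14} = dd 1 2 Q`,
`h^{23} = dd 0 3 Q`, variables indexed `0,1,2,3`),
`2 Q_{x₁} (h^{12} h^{34} - h^{14} h^{23})
  = Q (h^{12}_{x₁} h^{34} - h^{14}_{x₁} h^{23} + h^{23} h^{34}_{x₃} - h^{23}_{x₃} h^{34})`. -/
theorem statement5 (Q : MvPolynomial (Fin 4) ℂ) (hQ : ∀ i, Q.degreeOf i ≤ 1) :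
    2 * pderiv 0 Q * (dd 2 3 Q * dd 0 1 Q - dd 1 2 Q * dd 0 3 Q) =
      Q * (pderiv 0 (dd 2 3 Q) * dd 0 1 Q - pderiv 0 (dd 1 2 Q) * dd 0 3 Q
        + dd 0 3 Q * pderiv 2 (dd 0 1 Q) - pderiv 2 (dd 0 3 Q) * dd 0 1 Q) := by
  simp only [dd, map_sub, Derivation.leibniz, smul_eq_mul]
  simp only [pderiv_pderiv_comm (2 : Fin 4) 0, pderiv_pderiv_comm (2 : Fin 4) 1]
  ring
end

section
/- Let r(x) = r₄x⁴ + r₃x³ + r₂x² + r₁x + r₀ be a polynomial of degree at most 4 with complex coefficients, let a,b,c,d ∈ ℂ, and define the Möbius-transformed polynomial M[r](x) := Σ_{i=0}^{4} r_i (a x + b)^i (c x + d)^{4−i}. Then g₂(M[r]) = (ad − bc)⁴ · g₂(r) and g₃(M[r]) = (ad − bc)⁶ · g₃(r). -/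
open Polynomial

/-- `g₂(r) = (12 r₀ r₄ - 3 r₁ r₃ + r₂²)/12` for a polynomial of degree at most 4. -/
noncomputable def g2 (p : Polynomial ℂ) : ℂ :=
  (12 * p.coeff 0 * p.coeff 4 - 3 * p.coeff 1 * p.coeff 3 + (p.coeff 2) ^ 2) / 12

/-- `g₃(r) = (72 r₀ r₂ r₄ - 27 r₁² r₄ + 9 r₁ r₂ r₃ - 27 r₀ r₃² - 2 r₂³)/432` for a polynomial
of degree at most 4. -/
noncomputable def g3 (p : Polynomial ℂ) : ℂ :=
  (72 * p.coeff 0 * p.coeff 2 * p.coeff 4 - 27 * (p.coeff 1) ^ 2 * p.coeff 4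
    + 9 * p.coeff 1 * p.coeff 2 * p.coeff 3 - 27 * p.coeff 0 * (p.coeff 3) ^ 2
    - 2 * (p.coeff 2) ^ 3) / 432

/-- The quartic `r(x) = Σ_{i=0}^{4} r_i x^i`. -/
noncomputable def quartic (r : Fin 5 → ℂ) : Polynomial ℂ :=
  ∑ i : Fin 5, C (r i) * X ^ (i : ℕ)

/-- The Möbius transform `M[r](x) = Σ_{i=0}^{4} r_i (ax+b)^i (cx+d)^{4-i}`. -/
noncomputable def mobQuartic (r : Fin 5 → ℂ) (a b c d : ℂ) : Polynomial ℂ :=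
  ∑ i : Fin 5, Polynomial.C (r i) * (C a * X + C b) ^ (i : ℕ) * (C c * X + C d) ^ (4 - (i : ℕ))

@[simp]
theorem coeff_quartic (r : Fin 5 → ℂ) (i : Fin 5) : (quartic r).coeff i = r i := by
  simp [quartic, coeff_X_pow, Fin.val_inj]

/-- The coefficients of the Möbius transform of a quartic. -/
def mobCoeff (r : Fin 5 → ℂ) (a b c d : ℂ) : Fin 5 → ℂ :=
  ![r 0 * d ^ 4 + r 1 * b * d ^ 3
      + r 2 * b ^ 2 * d ^ 2 + r 3 * b ^ 3 * d
      + r 4 * b ^ 4,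
    r 0 * 4 * c * d ^ 3 + r 1 * (3 * b * c * d ^ 2 + a * d ^ 3)
      + r 2 * (2 * b ^ 2 * c * d + 2 * a * b * d ^ 2) + r 3 * (b ^ 3 * c + 3 * a * b ^ 2 * d)
      + r 4 * 4 * a * b ^ 3,
    r 0 * 6 * c ^ 2 * d ^ 2 + r 1 * (3 * b * c ^ 2 * d + 3 * a * c * d ^ 2)
      + r 2 * (b ^ 2 * c ^ 2 + 4 * a * b * c * d + a ^ 2 * d ^ 2)
      + r 3 * (3 * a * b ^ 2 * c + 3 * a ^ 2 * b * d)
      + r 4 * 6 * a ^ 2 * b ^ 2,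
    r 0 * 4 * c ^ 3 * d + r 1 * (b * c ^ 3 + 3 * a * c ^ 2 * d)
      + r 2 * (2 * a * b * c ^ 2 + 2 * a ^ 2 * c * d) + r 3 * (3 * a ^ 2 * b * c + a ^ 3 * d)
      + r 4 * 4 * a ^ 3 * b,
    r 0 * c ^ 4 + r 1 * a * c ^ 3
      + r 2 * a ^ 2 * c ^ 2 + r 3 * a ^ 3 * c
      + r 4 * a ^ 4]

theorem mobQuartic_eq_quartic (r : Fin 5 → ℂ) (a b c d : ℂ) :
    mobQuartic r a b c d = quartic (mobCoeff r a b c d) := by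
  simp [mobQuartic, quartic, mobCoeff, Fin.sum_univ_five, map_ofNat C]
  ring

theorem g2_quartic (r : Fin 5 → ℂ) :
    g2 (quartic r) = (12 * r 0 * r 4 - 3 * r 1 * r 3 + r 2 ^ 2) / 12 := by
  simp only [g2, ← coeff_quartic r]
  rfl

theorem g3_quartic (r : Fin 5 → ℂ) :
    g3 (quartic r) = (72 * r 0 * r 2 * r 4 - 27 * r 1 ^ 2 * r 4 + 9 * r 1 * r 2 * r 3
      - 27 * r 0 * r 3 ^ 2 - 2 * r 2 ^ 3) / 432 := by
  simp only [g3, ← coeff_quartic r]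
  rfl

/-- Under a Möbius transformation, `g₂` and `g₃` of a quartic polynomial are multiplied by
`(ad - bc)⁴` and `(ad - bc)⁶` respectively. -/
theorem statement9 (r : Fin 5 → ℂ) (a b c d : ℂ) :
    g2 (mobQuartic r a b c d) = (a * d - b * c) ^ 4 * g2 (quartic r) ∧
    g3 (mobQuartic r a b c d) = (a * d - b * c) ^ 6 * g3 (quartic r) := by
  simp only [mobQuartic_eq_quartic, g2_quartic, g3_quartic, mobCoeff, Matrix.cons_val]
  constructor <;> ring
end

section
/- (3D-consistency of Q1.) Fix δ ∈ ℂ and define Q(x,u,v,w; α,β) := α(x−v)(u−w) − β(x−u)(v−w) + δαβ(α−β). Let α₁,α₂,α₃ ∈ ℂ and x, x₁, x₂, x₃, x₁₂, x₁₃, x₂₃, y, z, w ∈ ℂ satisfy the six equations Q(x,x₁,x₂,x₁₂; α₁,α₂) = 0, Q(x,x₁,x₃,x₁₃; α₁,α₃) = 0, Q(x,x₂,x₃,x₂₃; α₂,α₃) = 0, Q(x₃,x₁₃,x₂₃,y; α₁,α₂) = 0, Q(x₂,x₁₂,x₂₃,z; α₁,α₃) = 0, Q(x₁,x₁₂,x₁₃,w;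 α₂,α₃) = 0, together with the nondegeneracy conditions that the coefficient of the fourth argument in each of the six equations is nonzero: α₂(x−x₁) − α₁(x−x₂) ≠ 0, α₃(x−x₁) − α₁(x−x₃) ≠ 0, α₃(x−x₂) − α₂(x−x₃) ≠ 0, α₂(x₃−x₁₃) − α₁(x₃−x₂₃) ≠ 0, α₃(x₂−x₁₂) − α₁(x₂−x₂₃) ≠ 0, α₃(x₁−x₁₂) − α₂(x₁−x₁₃) ≠ 0. Then y = z = w. -/
/-- The quad-equation Q1: `Q(x,u,v,w;α,β) = α(x-v)(u-w) - β(x-u)(v-w) + δαβ(α-β)`. -/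
def Q1 (δ x u v w α β : ℂ) : ℂ :=
  α * (x - v) * (u - w) - β * (x - u) * (v - w) + δ * α * β * (α - β)

/-- On a cube with value `0` at one vertex, two of the faces meeting at the opposite vertex
determine the same value there. -/
theorem Q1_far_vertex_eq (δ a b c p q r s t m y z : ℂ)
    (e1 : Q1 δ 0 p q s a b = 0) (e2 : Q1 δ 0 p r t a c = 0) (e3 : Q1 δ 0 q r m b c = 0)
    (e4 : Q1 δ r t m y a b = 0) (e5 : Q1 δ q s m z a c = 0)
    (n1 : a * q - b * p ≠ 0) (n2 : a * r - c * p ≠ 0) (n3 : b * r - c * q ≠ 0)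
    (n4 : b * (r - t) - a * (r - m) ≠ 0) (n5 : c * (q - s) - a * (q - m) ≠ 0) : y = z := by
  simp only [Q1] at e1 e2 e3 e4 e5
  have hs : s = (a - b) * (p * q - δ * a * b) / (a * q - b * p) := by
    rw [eq_div_iff n1]; linear_combination e1
  have ht : t = (a - c) * (p * r - δ * a * c) / (a * r - c * p) := by
    rw [eq_div_iff n2]; linear_combination e2
  have hm : m = (b - c) * (q * r - δ * b * c) / (b * r - c * q) := by
    rw [eq_div_iff n3]; linear_combination e3
  have hy : y = (b * (r - t) * m - a * (r - m) * t - δ * a * b * (a - b)) /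
      (b * (r - t) - a * (r - m)) := by
    rw [eq_div_iff n4]; linear_combination e4
  have hz : z = (c * (q - s) * m - a * (q - m) * s - δ * a * c * (a - c)) /
      (c * (q - s) - a * (q - m)) := by
    rw [eq_div_iff n5]; linear_combination e5
  rw [hy, hz, div_eq_div_iff n4 n5, hs, ht, hm]
  clear * - n1 n2 n3
  generalize hA : a * q - b * p = A at *
  generalize hB : a * r - c * p = B at *
  generalize hC : b * r - c * q = C at *
  field_simp
  subst hA hB hC
  ring

/-- Q1 is invariant under a common translation of its field arguments. -/
theorem Q1_sub (δ x u v w α β k : ℂ) :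
    Q1 δ (x - k) (u - k) (v - k) (w - k) α β = Q1 δ x u v w α β := by
  simp only [Q1]; ring

/-- Q1 is antisymmetric under the exchange of the two lattice directions. -/
theorem Q1_swap (δ x u v w α β : ℂ) : Q1 δ x v u w β α = -Q1 δ x u v w α β := by
  simp only [Q1]; ring

/-- 3D-consistency of the equation Q1: the three values of `x₁₂₃` obtained from the three
top faces of the cube coincide, provided the six quad-equations are nondegenerate in their
fourth argument. -/
theorem statement17 (δ α₁ α₂ α₃ x x₁ x₂ x₃ x₁₂ x₁₃ x₂₃ y z w : ℂ)
    (e1 : Q1 δ x x₁ x₂ x₁₂ α₁ α₂ = 0)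
    (e2 : Q1 δ x x₁ x₃ x₁₃ α₁ α₃ = 0)
    (e3 : Q1 δ x x₂ x₃ x₂₃ α₂ α₃ = 0)
    (e4 : Q1 δ x₃ x₁₃ x₂₃ y α₁ α₂ = 0)
    (e5 : Q1 δ x₂ x₁₂ x₂₃ z α₁ α₃ = 0)
    (e6 : Q1 δ x₁ x₁₂ x₁₃ w α₂ α₃ = 0)
    (n1 : α₂ * (x - x₁) - α₁ * (x - x₂) ≠ 0)
    (n2 : α₃ * (x - x₁) - α₁ * (x - x₃) ≠ 0)
    (n3 : α₃ * (x - x₂) - α₂ * (x - x₃) ≠ 0)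
    (n4 : α₂ * (x₃ - x₁₃) - α₁ * (x₃ - x₂₃) ≠ 0)
    (n5 : α₃ * (x₂ - x₁₂) - α₁ * (x₂ - x₂₃) ≠ 0)
    (n6 : α₃ * (x₁ - x₁₂) - α₂ * (x₁ - x₁₃) ≠ 0) :
    y = z ∧ z = w := by
  have h1 := (Q1_sub δ x x₁ x₂ x₁₂ α₁ α₂ x).trans e1
  have h2 := (Q1_sub δ x x₁ x₃ x₁₃ α₁ α₃ x).trans e2
  have h3 := (Q1_sub δ x x₂ x₃ x₂₃ α₂ α₃ x).trans e3
  have h4 := (Q1_sub δ x₃ x₁₃ x₂₃ y α₁ α₂ x).trans e4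
  have h5 := (Q1_sub δ x₂ x₁₂ x₂₃ z α₁ α₃ x).trans e5
  have h6 := (Q1_sub δ x₁ x₁₂ x₁₃ w α₂ α₃ x).trans e6
  rw [sub_self] at h1 h2 h3
  have swap : ∀ {p u v q a b : ℂ}, Q1 δ p u v q a b = 0 → Q1 δ p v u q b a = 0 := by
    intro p u v q a b h
    rw [Q1_swap, h, neg_zero]
  constructor
  · refine sub_left_injective (b := x) (Q1_far_vertex_eq δ α₁ α₂ α₃ _ _ _ _ _ _ _ _
      h1 h2 h3 h4 h5 ?_ ?_ ?_ ?_ ?_)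
    · convert n1 using 1; ring
    · convert n2 using 1; ring
    · convert n3 using 1; ring
    · convert n4 using 1; ring
    · convert n5 using 1; ring
  · refine sub_left_injective (b := x) (Q1_far_vertex_eq δ α₃ α₁ α₂ _ _ _ _ _ _ _ _
      (swap h2) (swap h3) h1 (swap h5) (swap h6) ?_ ?_ ?_ ?_ ?_)
    · convert neg_ne_zero.2 n2 using 1; ring
    · convert neg_ne_zero.2 n3 using 1; ring
    · convert n1 using 1; ring
    · convert neg_ne_zero.2 n5 using 1; ring
    · convert neg_ne_zero.2 n6 using 1; ring
end

section
/- (3D-consistency of the discrete potential KdV equation H1.) Let α₁, α₂, α₃ ∈ ℂ and x, x₁, x₂, x₃ ∈ ℂ with x₁ ≠ x₂, x₁ ≠ x₃, x₂ ≠ x₃. Define x₁₂ := x − (α₁−α₂)/(x₁−x₂), x₁₃ := x − (α₁−α₃)/(x₁−x₃), x₂₃ := x − (α₂−α₃)/(x₂−x₃), and assume x₁₃ ≠ x₂₃, x₁₂ ≠ x₂₃, x₁₂ ≠ x₁₃. Then the three values x₃ − (α₁−α₂)/(x₁₃−x₂₃), x₂ − (α₁−α₃)/(x₁₂−x₂₃),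 and x₁ − (α₂−α₃)/(x₁₂−x₁₃) all coincide. -/
/-- 3D-consistency of the discrete potential KdV equation
`(x - x_{ij})(x_i - x_j) + α_j - α_i = 0`, i.e. `x_{ij} = x - (α_i - α_j)/(x_i - x_j)`:
the three values of `x₁₂₃` obtained from the three top faces of the cube coincide. -/
theorem statement18 (α₁ α₂ α₃ x x₁ x₂ x₃ x₁₂ x₁₃ x₂₃ : ℂ)
    (h12 : x₁ ≠ x₂) (h13 : x₁ ≠ x₃) (h23 : x₂ ≠ x₃)
    (d12 : x₁₂ = x - (α₁ - α₂) / (x₁ - x₂))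
    (d13 : x₁₃ = x - (α₁ - α₃) / (x₁ - x₃))
    (d23 : x₂₃ = x - (α₂ - α₃) / (x₂ - x₃))
    (h1323 : x₁₃ ≠ x₂₃) (h1223 : x₁₂ ≠ x₂₃) (h1213 : x₁₂ ≠ x₁₃) :
    x₃ - (α₁ - α₂) / (x₁₃ - x₂₃) = x₂ - (α₁ - α₃) / (x₁₂ - x₂₃) ∧
    x₂ - (α₁ - α₃) / (x₁₂ - x₂₃) = x₁ - (α₂ - α₃) / (x₁₂ - x₁₃) := by
  have s12 : x₁ - x₂ ≠ 0 := sub_ne_zero.mpr h12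
  have s13 : x₁ - x₃ ≠ 0 := sub_ne_zero.mpr h13
  have s23 : x₂ - x₃ ≠ 0 := sub_ne_zero.mpr h23
  have t1 : x₁₃ - x₂₃ ≠ 0 := sub_ne_zero.mpr h1323
  have t2 : x₁₂ - x₂₃ ≠ 0 := sub_ne_zero.mpr h1223
  have t3 : x₁₂ - x₁₃ ≠ 0 := sub_ne_zero.mpr h1213
  have e12 : α₁ - α₂ = (x - x₁₂) * (x₁ - x₂) := by
    rw [d12, sub_sub_cancel, div_mul_cancel₀ _ s12]
  have e13 : α₁ - α₃ = (x - x₁₃) * (x₁ - x₃) := by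
    rw [d13, sub_sub_cancel, div_mul_cancel₀ _ s13]
  have e23 : α₂ - α₃ = (x - x₂₃) * (x₂ - x₃) := by
    rw [d23, sub_sub_cancel, div_mul_cancel₀ _ s23]
  have star_triangle : (x₁₂ - x₂₃) * (x₁ - x₂) = (x₁₃ - x₂₃) * (x₁ - x₃) := by
    linear_combination e12 + e23 - e13
  clear d12 d13 d23
  rw [e12, e13, e23]
  constructor
  · rw [sub_eq_sub_iff_sub_eq_sub, div_sub_div _ _ t1 t2, eq_div_iff (mul_ne_zero t1 t2)]
    linear_combination (x₁₂ - x₂₃ - (x - x₁₃)) * star_triangle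
  · rw [sub_eq_sub_iff_sub_eq_sub, div_sub_div _ _ t2 t3, eq_div_iff (mul_ne_zero t2 t3)]
    linear_combination -(x₁₂ - x₂₃ + (x - x₁₃)) * star_triangle
end

section
/- (Classification of affine-linear equations of type Q.) Let Q(x₁,x₂,x₃,x₄) ∈ ℂ[x₁,x₂,x₃,x₄] be affine-linear and irreducible, with Q_{x_i} not identically zero for each i, and suppose Q is of type Q, i.e., all four accompanying biquadratics h^{ij} := δ_{x_k,x_l}(Q) ({i,j,k,l} = {1,2,3,4}) are nondegenerate. Then there exist Möbius data (a_i, b_i, c_i, d_i) ∈ ℂ⁴ with a_i d_i − b_i c_i ≠ 0 for i = 1,…,4 and a nonzero constant μ ∈ ℂ such that μ·M[Q] equals one of the following polynomials: (Q4) αβγ(k²x₁x₂x₃x₄ + 1) + α(x₁x₂ + x₃x₄) + β(x₁x₄ + x₂x₃) + γ(x₁x₃ + x₂x₄), for some k, α, β, A, B ∈ ℂ with A² = (α²−1)(k²α²−1), B² = (β²−1)(k²β²−1), k²α²β² ≠ 1 and γ := (αB + βA)/(k²α²β² − 1); or (Q3) (α−α⁻¹)(x₁x₂ + x₃x₄)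 + (β−β⁻¹)(x₁x₄ + x₂x₃) − (αβ − α⁻¹β⁻¹)(x₁x₃ + x₂x₄) + (δ/4)(α−α⁻¹)(β−β⁻¹)(αβ − α⁻¹β⁻¹), for some nonzero α, β ∈ ℂ and δ ∈ ℂ; or (Q2) α(x₁−x₄)(x₂−x₃) + β(x₁−x₂)(x₄−x₃) − αβ(α+β)(x₁+x₂+x₃+x₄) + αβ(α+β)(α²+αβ+β²), for some α, β ∈ ℂ; or (Q1) α(x₁−x₄)(x₂−x₃) + β(x₁−x₂)(x₄−x₃) − δαβ(α+β), for some α, β, δ ∈ ℂ. -/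
open MvPolynomial

/-- Substitution of the constant `c` for the variable `x_i`. -/
noncomputable def substVar (i : Fin 4) (c : ℂ) (h : MvPolynomial (Fin 4) ℂ) :
    MvPolynomial (Fin 4) ℂ :=
  aeval (Function.update (X : Fin 4 → MvPolynomial (Fin 4) ℂ) i (C c)) h

/-- Non-degeneracy of a biquadratic polynomial `h` in the variables `x_i, x_j`:
no member of its Möbius equivalence class is divisible by a factor `x_i - c` or `x_j - c`;
equivalently, `h(c, x_j) ≠ 0` and `h(x_i, c) ≠ 0` for every `c ∈ ℂ`, and the coefficients of
`x_i²` and of `x_j²` in `h` are nonzero (the latter expressed via second derivatives). -/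
def Nondeg (h : MvPolynomial (Fin 4) ℂ) (i j : Fin 4) : Prop :=
  (∀ c : ℂ, substVar i c h ≠ 0) ∧ (∀ c : ℂ, substVar j c h ≠ 0) ∧
    pderiv i (pderiv i h) ≠ 0 ∧ pderiv j (pderiv j h) ≠ 0

/-- The Möbius transform of an affine-linear polynomial
`Q = Σ_S q_S Π_{i∈S} x_i`:
`M[Q] = Σ_S q_S Π_{i∈S}(a_i x_i + b_i) Π_{i∉S}(c_i x_i + d_i)`. -/
noncomputable def mob (Q : MvPolynomial (Fin 4) ℂ) (a b c d : Fin 4 → ℂ) :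
    MvPolynomial (Fin 4) ℂ :=
  ∑ S ∈ (Finset.univ : Finset (Fin 4)).powerset,
    C (Q.coeff (∑ i ∈ S, Finsupp.single i 1)) *
      ((∏ i ∈ S, (C (a i) * X i + C (b i))) * ∏ i ∈ Sᶜ, (C (c i) * X i + C (d i)))

/-- Sums over the subsets of `Fin 4`, indexed by characteristic functions. -/
theorem sum_powerset_fin_four {M : Type*} [AddCommMonoid M] (f : Finset (Fin 4) → M) :
    ∑ S ∈ (Finset.univ : Finset (Fin 4)).powerset, f S =
      ∑ i : Fin 2, ∑ j : Fin 2, ∑ k : Fin 2, ∑ l : Fin 2,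
        f (Finset.univ.filter fun m => (![i, j, k, l] : Fin 4 → Fin 2) m = 1) := by
  simp only [← Fintype.sum_prod_type']
  symm
  refine Finset.sum_bij (fun p _ => Finset.univ.filter fun m =>
    (![p.1, p.2.1, p.2.2.1, p.2.2.2] : Fin 4 → Fin 2) m = 1) ?_ ?_ ?_ ?_
  · intros; simp
  · decide
  · decide
  · intros; rfl

/-- Coefficient arrays of affine-linear polynomials in four variables. -/
abbrev Tensor : Type := Fin 2 → Fin 2 → Fin 2 → Fin 2 → ℂ

/-- The quadrilinear form with coefficient array `q`. -/
def ev (q : Tensor) (u v w z : Fin 2 → ℂ) : ℂ :=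
  ∑ i, ∑ j, ∑ k, ∑ l, q i j k l * (u i * v j * w k * z l)

/-- The coefficient array of the affine-linear part of a polynomial. -/
noncomputable def tens (Q : MvPolynomial (Fin 4) ℂ) : Tensor := fun i j k l =>
  Q.coeff (∑ m ∈ Finset.univ.filter fun m => (![i, j, k, l] : Fin 4 → Fin 2) m = 1,
    Finsupp.single m 1)

/-- The affine-linear polynomial with coefficient array `q`. -/
noncomputable def toPoly (q : Tensor) : MvPolynomial (Fin 4) ℂ :=
  ∑ i : Fin 2, ∑ j : Fin 2, ∑ k : Fin 2, ∑ l : Fin 2,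
    C (q i j k l) * (X 0 ^ (i : ℕ) * X 1 ^ (j : ℕ) * X 2 ^ (k : ℕ) * X 3 ^ (l : ℕ))

theorem eq_toPoly_tens (Q : MvPolynomial (Fin 4) ℂ) (haff : ∀ i, Q.degreeOf i ≤ 1) :
    Q = toPoly (tens Q) := by
  have h1 : Q = ∑ S ∈ (Finset.univ : Finset (Fin 4)).powerset,
      C (Q.coeff (∑ i ∈ S, Finsupp.single i 1)) * ∏ i ∈ S, X i := by
    have hinj : ∀ S T : Finset (Fin 4), (∑ i ∈ S, Finsupp.single i 1 : Fin 4 →₀ ℕ) =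
        ∑ i ∈ T, Finsupp.single i 1 → S = T := by
      intro S T h
      ext m
      have := DFunLike.congr_fun h m
      simp only [Finsupp.finsetSum_apply, Finsupp.single_apply, Finset.sum_ite_eq'] at this
      by_cases h1 : m ∈ S <;> by_cases h2 : m ∈ T <;> simp_all
    have hmon : ∀ S : Finset (Fin 4),
        (C (Q.coeff (∑ i ∈ S, Finsupp.single i 1)) * ∏ i ∈ S, X i : MvPolynomial (Fin 4) ℂ) =
        monomial (∑ i ∈ S, Finsupp.single i 1) (Q.coeff (∑ i ∈ S, Finsupp.single i 1)) := by
      intro S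
      rw [← mul_one (Q.coeff _), ← C_mul_monomial, mul_one, monomial_sum_one]
      simp [X]
    simp only [hmon]
    ext m
    rw [coeff_sum]
    simp only [coeff_monomial]
    by_cases hm : ∀ i, m i ≤ 1
    · have hS : (∑ i ∈ Finset.univ.filter (fun i => m i = 1), Finsupp.single i 1 : Fin 4 →₀ ℕ)
          = m := by
        ext i
        simp only [Finsupp.finsetSum_apply, Finsupp.single_apply, Finset.sum_ite_eq']
        have := hm i
        split_ifs with h <;> simp at h <;> omega
      rw [Finset.sum_eq_single (Finset.univ.filter (fun i => m i = 1))]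
      · simp [hS]
      · intro T _ hT
        rw [if_neg]
        intro h
        exact hT (hinj _ _ (h.trans hS.symm))
      · simp
    · push Not at hm
      obtain ⟨i, hi⟩ := hm
      have h0 : Q.coeff m = 0 := by
        by_contra h
        have := (degreeOf_le_iff.1 (haff i)) m (mem_support_iff.2 h)
        omega
      rw [h0, Finset.sum_eq_zero]
      intro T _
      split_ifs with h
      · rw [h, h0]
      · rfl
  rw [sum_powerset_fin_four] at h1
  conv_lhs => rw [h1]
  simp only [toPoly]
  refine Finset.sum_congr rfl fun i _ => Finset.sum_congr rfl fun j _ =>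
    Finset.sum_congr rfl fun k _ => Finset.sum_congr rfl fun l _ => ?_
  rw [tens]
  congr 1
  rw [Finset.prod_filter, Fin.prod_univ_four]
  fin_cases i <;> fin_cases j <;> fin_cases k <;> fin_cases l <;> simp

theorem eval_mob (Q : MvPolynomial (Fin 4) ℂ) (a b c d x : Fin 4 → ℂ) :
    eval x (mob Q a b c d) = ev (tens Q) ![c 0 * x 0 + d 0, a 0 * x 0 + b 0]
      ![c 1 * x 1 + d 1, a 1 * x 1 + b 1] ![c 2 * x 2 + d 2, a 2 * x 2 + b 2]
      ![c 3 * x 3 + d 3, a 3 * x 3 + b 3] := by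
  rw [mob, sum_powerset_fin_four, ev]
  simp only [map_sum]
  refine Finset.sum_congr rfl fun i _ => Finset.sum_congr rfl fun j _ =>
    Finset.sum_congr rfl fun k _ => Finset.sum_congr rfl fun l _ => ?_
  rw [map_mul, eval_C, tens]
  congr 1
  rw [Finset.compl_filter, Finset.prod_filter, Finset.prod_filter, Fin.prod_univ_four,
    Fin.prod_univ_four]
  fin_cases i <;> fin_cases j <;> fin_cases k <;> fin_cases l <;> simp <;> ring

/-- The discriminant-type expression of a bilinear form on `ℂ²`. -/
def det22 (F : (Fin 2 → ℂ) → (Fin 2 → ℂ) → ℂ) : ℂ :=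
  F ![0, 1] ![1, 0] * F ![1, 0] ![0, 1] - F ![1, 0] ![1, 0] * F ![0, 1] ![0, 1]

/-- The homogenized biquadratic in the first and second variables. -/
def h12 (q : Tensor) (u v : Fin 2 → ℂ) : ℂ := det22 fun w z => ev q u v w z

/-- The homogenized biquadratic in the second and third variables. -/
def h23 (q : Tensor) (v w : Fin 2 → ℂ) : ℂ := det22 fun u z => ev q u v w z

/-- The homogenized biquadratic in the third and fourth variables. -/
def h34 (q : Tensor) (w z : Fin 2 → ℂ) : ℂ := det22 fun u v => ev q u v w z

/-- The homogenized biquadratic in the first and fourth variables. -/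
def h14 (q : Tensor) (u z : Fin 2 → ℂ) : ℂ := det22 fun v w => ev q u v w z

/-- A biquadratic form vanishes identically for no fixed value of either argument. -/
def NoFactor (h : (Fin 2 → ℂ) → (Fin 2 → ℂ) → ℂ) : Prop :=
  (∀ u, u ≠ 0 → ∃ v, h u v ≠ 0) ∧ ∀ v, v ≠ 0 → ∃ u, h u v ≠ 0

theorem exists_eval_ne_zero {p : MvPolynomial (Fin 4) ℂ} (hp : p ≠ 0) : ∃ x, eval x p ≠ 0 := by
  by_contra! h
  exact hp (MvPolynomial.funext fun x => by simpa using h x)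

theorem eval_substVar (x : Fin 4 → ℂ) (i : Fin 4) (c : ℂ) (h : MvPolynomial (Fin 4) ℂ) :
    eval x (substVar i c h) = eval (Function.update x i c) h := by
  have : (eval x).comp (aeval (Function.update (X : Fin 4 → MvPolynomial (Fin 4) ℂ) i (C c)) :
      MvPolynomial (Fin 4) ℂ →ₐ[ℂ] MvPolynomial (Fin 4) ℂ).toRingHom =
      eval (Function.update x i c) := by
    ext j
    · simp
    · by_cases hj : j = i
      · subst hj; simp
      · simp [Function.update_of_ne hj]
  exact RingHom.congr_fun this h

theorem noFactor_of_nondeg {h : MvPolynomial (Fin 4) ℂ} {i j : Fin 4} (hij : i ≠ j)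
    {H : (Fin 2 → ℂ) → (Fin 2 → ℂ) → ℂ} (hnd : Nondeg h i j)
    (hH : ∀ x, eval x h = H ![1, x i] ![1, x j])
    (hi : ∀ x, eval x (pderiv i (pderiv i h)) = 2 * H ![0, 1] ![1, x j])
    (hj : ∀ x, eval x (pderiv j (pderiv j h)) = 2 * H ![1, x i] ![0, 1])
    (hl : ∀ (s : ℂ) u v, H (s • u) v = s ^ 2 * H u v)
    (hr : ∀ (s : ℂ) u v, H u (s • v) = s ^ 2 * H u v) : NoFactor H := by
  have key : ∀ u : Fin 2 → ℂ, u ≠ 0 → (∃ s : ℂ, s ≠ 0 ∧ ∃ c, u = s • ![1, c]) ∨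
      ∃ s : ℂ, s ≠ 0 ∧ u = s • ![0, 1] := by
    intro u hu
    by_cases h0 : u 0 = 0
    · refine Or.inr ⟨u 1, fun h1 => hu ?_, ?_⟩
      · ext k; fin_cases k <;> simp [h0, h1]
      · ext k; fin_cases k <;> simp [h0]
    · refine Or.inl ⟨u 0, h0, u 1 / u 0, ?_⟩
      ext k; fin_cases k <;> simp [mul_div_cancel₀ _ h0]
  obtain ⟨n1, n2, n3, n4⟩ := hnd
  constructor
  · intro u hu
    rcases key u hu with ⟨s, hs, c, rfl⟩ | ⟨s, hs, rfl⟩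
    · obtain ⟨x, hx⟩ := exists_eval_ne_zero (n1 c)
      rw [eval_substVar, hH] at hx
      simp only [Function.update_self, Function.update_of_ne hij.symm] at hx
      exact ⟨_, by rw [hl]; exact mul_ne_zero (pow_ne_zero 2 hs) hx⟩
    · obtain ⟨x, hx⟩ := exists_eval_ne_zero n3
      rw [hi] at hx
      exact ⟨_, by rw [hl]; exact mul_ne_zero (pow_ne_zero 2 hs) (right_ne_zero_of_mul hx)⟩
  · intro u hu
    rcases key u hu with ⟨s, hs, c, rfl⟩ | ⟨s, hs, rfl⟩
    · obtain ⟨x, hx⟩ := exists_eval_ne_zero (n2 c)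
      rw [eval_substVar, hH] at hx
      simp only [Function.update_self, Function.update_of_ne hij] at hx
      exact ⟨_, by rw [hr]; exact mul_ne_zero (pow_ne_zero 2 hs) hx⟩
    · obtain ⟨x, hx⟩ := exists_eval_ne_zero n4
      rw [hj] at hx
      exact ⟨_, by rw [hr]; exact mul_ne_zero (pow_ne_zero 2 hs) (right_ne_zero_of_mul hx)⟩

theorem toPoly_eq (q : Tensor) : toPoly q =
    C (q 0 0 0 0) + C (q 1 0 0 0) * X 0 + C (q 0 1 0 0) * X 1 + C (q 0 0 1 0) * X 2
      + C (q 0 0 0 1) * X 3 + C (q 1 1 0 0) * (X 0 * X 1) + C (q 1 0 1 0) * (X 0 * X 2)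
      + C (q 1 0 0 1) * (X 0 * X 3) + C (q 0 1 1 0) * (X 1 * X 2) + C (q 0 1 0 1) * (X 1 * X 3)
      + C (q 0 0 1 1) * (X 2 * X 3) + C (q 1 1 1 0) * (X 0 * X 1 * X 2)
      + C (q 1 1 0 1) * (X 0 * X 1 * X 3) + C (q 1 0 1 1) * (X 0 * X 2 * X 3)
      + C (q 0 1 1 1) * (X 1 * X 2 * X 3) + C (q 1 1 1 1) * (X 0 * X 1 * X 2 * X 3) := by
  simp [toPoly, Fin.sum_univ_two]
  ring

theorem noFactor_h12 {q : Tensor} (h : Nondeg (dd 2 3 (toPoly q)) 0 1) : NoFactor (h12 q) := by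
  refine noFactor_of_nondeg (by decide) h ?_ ?_ ?_ ?_ ?_ <;> intros <;>
    simp [dd, toPoly_eq, pderiv_X, h12, det22, ev, Fin.sum_univ_two, Derivation.leibniz] <;> ring

theorem noFactor_h23 {q : Tensor} (h : Nondeg (dd 0 3 (toPoly q)) 1 2) : NoFactor (h23 q) := by
  refine noFactor_of_nondeg (by decide) h ?_ ?_ ?_ ?_ ?_ <;> intros <;>
    simp [dd, toPoly_eq, pderiv_X, h23, det22, ev, Fin.sum_univ_two, Derivation.leibniz] <;> ring

theorem noFactor_h34 {q : Tensor} (h : Nondeg (dd 0 1 (toPoly q)) 2 3) : NoFactor (h34 q) := by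
  refine noFactor_of_nondeg (by decide) h ?_ ?_ ?_ ?_ ?_ <;> intros <;>
    simp [dd, toPoly_eq, pderiv_X, h34, det22, ev, Fin.sum_univ_two, Derivation.leibniz] <;> ring

theorem noFactor_h14 {q : Tensor} (h : Nondeg (dd 1 2 (toPoly q)) 0 3) : NoFactor (h14 q) := by
  refine noFactor_of_nondeg (by decide) h ?_ ?_ ?_ ?_ ?_ <;> intros <;>
    simp [dd, toPoly_eq, pderiv_X, h14, det22, ev, Fin.sum_univ_two, Derivation.leibniz] <;> ring

/-- All four biquadratic forms of `q` attached to the edges are free of constant factors. -/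
structure TypeQ (q : Tensor) : Prop where
  n12 : NoFactor (h12 q)
  n23 : NoFactor (h23 q)
  n34 : NoFactor (h34 q)
  n14 : NoFactor (h14 q)

/-- Simultaneous linear substitution in the four arguments. -/
def act (q : Tensor) (g₁ g₂ g₃ g₄ : Matrix (Fin 2) (Fin 2) ℂ) : Tensor := fun i j k l =>
  ev q (fun m => g₁ m i) (fun m => g₂ m j) (fun m => g₃ m k) (fun m => g₄ m l)

theorem ev_apply₁ (q : Tensor) (u v w z : Fin 2 → ℂ) :
    ev q u v w z = u 0 * ev q ![1, 0] v w z + u 1 * ev q ![0, 1] v w z := by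
  simp [ev, Fin.sum_univ_two]; ring

theorem ev_apply₂ (q : Tensor) (u v w z : Fin 2 → ℂ) :
    ev q u v w z = v 0 * ev q u ![1, 0] w z + v 1 * ev q u ![0, 1] w z := by
  simp [ev, Fin.sum_univ_two]; ring

theorem ev_apply₃ (q : Tensor) (u v w z : Fin 2 → ℂ) :
    ev q u v w z = w 0 * ev q u v ![1, 0] z + w 1 * ev q u v ![0, 1] z := by
  simp [ev, Fin.sum_univ_two]; ring

theorem ev_apply₄ (q : Tensor) (u v w z : Fin 2 → ℂ) :
    ev q u v w z = z 0 * ev q u v w ![1, 0] + z 1 * ev q u v w ![0, 1] := by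
  simp [ev, Fin.sum_univ_two]; ring

theorem ev_mulVec₁ (q : Tensor) (g : Matrix (Fin 2) (Fin 2) ℂ) (u v w z : Fin 2 → ℂ) :
    ev q (g.mulVec u) v w z =
      u 0 * ev q (fun m => g m 0) v w z + u 1 * ev q (fun m => g m 1) v w z := by
  rw [ev_apply₁ q (g.mulVec u), ev_apply₁ q (fun m => g m 0), ev_apply₁ q (fun m => g m 1)]
  simp [Matrix.mulVec, dotProduct, Fin.sum_univ_two]; ring

theorem ev_mulVec₂ (q : Tensor) (g : Matrix (Fin 2) (Fin 2) ℂ) (u v w z : Fin 2 → ℂ) :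
    ev q u (g.mulVec v) w z =
      v 0 * ev q u (fun m => g m 0) w z + v 1 * ev q u (fun m => g m 1) w z := by
  rw [ev_apply₂ q u (g.mulVec v), ev_apply₂ q u (fun m => g m 0),
    ev_apply₂ q u (fun m => g m 1)]
  simp [Matrix.mulVec, dotProduct, Fin.sum_univ_two]; ring

theorem ev_mulVec₃ (q : Tensor) (g : Matrix (Fin 2) (Fin 2) ℂ) (u v w z : Fin 2 → ℂ) :
    ev q u v (g.mulVec w) z =
      w 0 * ev q u v (fun m => g m 0) z + w 1 * ev q u v (fun m => g m 1) z := by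
  rw [ev_apply₃ q u v (g.mulVec w), ev_apply₃ q u v (fun m => g m 0),
    ev_apply₃ q u v (fun m => g m 1)]
  simp [Matrix.mulVec, dotProduct, Fin.sum_univ_two]; ring

theorem ev_mulVec₄ (q : Tensor) (g : Matrix (Fin 2) (Fin 2) ℂ) (u v w z : Fin 2 → ℂ) :
    ev q u v w (g.mulVec z) =
      z 0 * ev q u v w (fun m => g m 0) + z 1 * ev q u v w (fun m => g m 1) := by
  rw [ev_apply₄ q u v w (g.mulVec z), ev_apply₄ q u v w (fun m => g m 0),
    ev_apply₄ q u v w (fun m => g m 1)]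
  simp [Matrix.mulVec, dotProduct, Fin.sum_univ_two]; ring

theorem ev_act (q : Tensor) (g₁ g₂ g₃ g₄ : Matrix (Fin 2) (Fin 2) ℂ) (u v w z : Fin 2 → ℂ) :
    ev (act q g₁ g₂ g₃ g₄) u v w z =
      ev q (g₁.mulVec u) (g₂.mulVec v) (g₃.mulVec w) (g₄.mulVec z) := by
  simp only [ev_mulVec₁, ev_mulVec₂, ev_mulVec₃, ev_mulVec₄]
  rw [ev]
  simp only [Fin.sum_univ_two, act]
  ring

/-- How `det22` changes under linear substitutions. -/
theorem det22_mulVec {F G : (Fin 2 → ℂ) → (Fin 2 → ℂ) → ℂ} {g g' : Matrix (Fin 2) (Fin 2) ℂ}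
    (h : ∀ u v, G u v = F (g.mulVec u) (g'.mulVec v))
    (hl : ∀ u v, F u v = u 0 * F ![1, 0] v + u 1 * F ![0, 1] v)
    (hr : ∀ u v, F u v = v 0 * F u ![1, 0] + v 1 * F u ![0, 1]) :
    det22 G = g.det * g'.det * det22 F := by
  have key : ∀ u v, F u v = u 0 * (v 0 * F ![1, 0] ![1, 0] + v 1 * F ![1, 0] ![0, 1]) +
      u 1 * (v 0 * F ![0, 1] ![1, 0] + v 1 * F ![0, 1] ![0, 1]) := by
    intro u v
    rw [hl, hr ![1, 0] v, hr ![0, 1] v]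
  simp only [det22, h]
  rw [key (g.mulVec ![0, 1]) (g'.mulVec ![1, 0]), key (g.mulVec ![1, 0]) (g'.mulVec ![0, 1]),
    key (g.mulVec ![1, 0]) (g'.mulVec ![1, 0]), key (g.mulVec ![0, 1]) (g'.mulVec ![0, 1])]
  simp [Matrix.mulVec, dotProduct, Fin.sum_univ_two, Matrix.det_fin_two]
  ring

theorem NoFactor.comp {h h' : (Fin 2 → ℂ) → (Fin 2 → ℂ) → ℂ} {g g' : Matrix (Fin 2) (Fin 2) ℂ}
    {c : ℂ} (hc : c ≠ 0) (hg : g.det ≠ 0) (hg' : g'.det ≠ 0)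
    (hh : ∀ u v, h' u v = c * h (g.mulVec u) (g'.mulVec v)) (hn : NoFactor h) : NoFactor h' := by
  have inj : ∀ {g : Matrix (Fin 2) (Fin 2) ℂ}, g.det ≠ 0 → ∀ u, u ≠ 0 → g.mulVec u ≠ 0 :=
    fun hg u hu h0 => hu (Matrix.eq_zero_of_mulVec_eq_zero hg h0)
  have surj : ∀ {g : Matrix (Fin 2) (Fin 2) ℂ}, g.det ≠ 0 → ∀ u, g.mulVec (g⁻¹.mulVec u) = u := by
    intro g hg u
    rw [Matrix.mulVec_mulVec, Matrix.mul_nonsing_inv _ (isUnit_iff_ne_zero.2 hg),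
      Matrix.one_mulVec]
  constructor
  · intro u hu
    obtain ⟨v, hv⟩ := hn.1 _ (inj hg u hu)
    refine ⟨g'⁻¹.mulVec v, ?_⟩
    rw [hh, surj hg']
    exact mul_ne_zero hc hv
  · intro v hv
    obtain ⟨u, hu⟩ := hn.2 _ (inj hg' v hv)
    refine ⟨g⁻¹.mulVec u, ?_⟩
    rw [hh, surj hg]
    exact mul_ne_zero hc hu

theorem h12_act (q : Tensor) (g₁ g₂ g₃ g₄ : Matrix (Fin 2) (Fin 2) ℂ) (u v : Fin 2 → ℂ) :
    h12 (act q g₁ g₂ g₃ g₄) u v =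
      g₃.det * g₄.det * h12 q (g₁.mulVec u) (g₂.mulVec v) :=
  det22_mulVec (fun w z => ev_act q g₁ g₂ g₃ g₄ u v w z)
    (fun _ _ => ev_apply₃ q _ _ _ _) (fun _ _ => ev_apply₄ q _ _ _ _)

theorem h23_act (q : Tensor) (g₁ g₂ g₃ g₄ : Matrix (Fin 2) (Fin 2) ℂ) (v w : Fin 2 → ℂ) :
    h23 (act q g₁ g₂ g₃ g₄) v w =
      g₁.det * g₄.det * h23 q (g₂.mulVec v) (g₃.mulVec w) :=
  det22_mulVec (fun u z => ev_act q g₁ g₂ g₃ g₄ u v w z)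
    (fun _ _ => ev_apply₁ q _ _ _ _) (fun _ _ => ev_apply₄ q _ _ _ _)

theorem h34_act (q : Tensor) (g₁ g₂ g₃ g₄ : Matrix (Fin 2) (Fin 2) ℂ) (w z : Fin 2 → ℂ) :
    h34 (act q g₁ g₂ g₃ g₄) w z =
      g₁.det * g₂.det * h34 q (g₃.mulVec w) (g₄.mulVec z) :=
  det22_mulVec (fun u v => ev_act q g₁ g₂ g₃ g₄ u v w z)
    (fun _ _ => ev_apply₁ q _ _ _ _) (fun _ _ => ev_apply₂ q _ _ _ _)

theorem h14_act (q : Tensor) (g₁ g₂ g₃ g₄ : Matrix (Fin 2) (Fin 2) ℂ) (u z : Fin 2 → ℂ) :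
    h14 (act q g₁ g₂ g₃ g₄) u z =
      g₂.det * g₃.det * h14 q (g₁.mulVec u) (g₄.mulVec z) :=
  det22_mulVec (fun v w => ev_act q g₁ g₂ g₃ g₄ u v w z)
    (fun _ _ => ev_apply₂ q _ _ _ _) (fun _ _ => ev_apply₃ q _ _ _ _)

theorem TypeQ.act {q : Tensor} (hq : TypeQ q) {g₁ g₂ g₃ g₄ : Matrix (Fin 2) (Fin 2) ℂ}
    (d₁ : g₁.det ≠ 0) (d₂ : g₂.det ≠ 0) (d₃ : g₃.det ≠ 0) (d₄ : g₄.det ≠ 0) :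
    TypeQ (act q g₁ g₂ g₃ g₄) where
  n12 := hq.n12.comp (mul_ne_zero d₃ d₄) d₁ d₂ (h12_act q g₁ g₂ g₃ g₄)
  n23 := hq.n23.comp (mul_ne_zero d₁ d₄) d₂ d₃ (h23_act q g₁ g₂ g₃ g₄)
  n34 := hq.n34.comp (mul_ne_zero d₁ d₂) d₃ d₄ (h34_act q g₁ g₂ g₃ g₄)
  n14 := hq.n14.comp (mul_ne_zero d₂ d₃) d₁ d₄ (h14_act q g₁ g₂ g₃ g₄)

/-- The polynomial functions in the list (Q4), (Q3), (Q2), (Q1). -/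
def IsCanonical (P : ℂ → ℂ → ℂ → ℂ → ℂ) : Prop :=
  (∃ k α β A B : ℂ,
    A ^ 2 = (α ^ 2 - 1) * (k ^ 2 * α ^ 2 - 1) ∧
    B ^ 2 = (β ^ 2 - 1) * (k ^ 2 * β ^ 2 - 1) ∧
    k ^ 2 * α ^ 2 * β ^ 2 ≠ 1 ∧
    ∀ x y z w, P x y z w =
      α * β * ((α * B + β * A) / (k ^ 2 * α ^ 2 * β ^ 2 - 1)) * (k ^ 2 * (x * y * z * w) + 1)
        + α * (x * y + z * w) + β * (x * w + y * z)
        + (α * B + β * A) / (k ^ 2 * α ^ 2 * β ^ 2 - 1) * (x * z + y * w)) ∨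
  (∃ α β δ : ℂ, α ≠ 0 ∧ β ≠ 0 ∧
    ∀ x y z w, P x y z w =
      (α - α⁻¹) * (x * y + z * w) + (β - β⁻¹) * (x * w + y * z)
        - (α * β - α⁻¹ * β⁻¹) * (x * z + y * w)
        + δ / 4 * (α - α⁻¹) * (β - β⁻¹) * (α * β - α⁻¹ * β⁻¹)) ∨
  (∃ α β : ℂ,
    ∀ x y z w, P x y z w =
      α * ((x - w) * (y - z)) + β * ((x - y) * (w - z))
        - α * β * (α + β) * (x + y + z + w)
        + α * β * (α + β) * (α ^ 2 + α * β + β ^ 2)) ∨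
  (∃ α β δ : ℂ,
    ∀ x y z w, P x y z w =
      α * ((x - w) * (y - z)) + β * ((x - y) * (w - z)) - δ * α * β * (α + β))

/-- `q` is equivalent to one of the canonical forms. -/
def Classified (q : Tensor) : Prop :=
  ∃ (g₁ g₂ g₃ g₄ : Matrix (Fin 2) (Fin 2) ℂ) (μ : ℂ),
    g₁.det ≠ 0 ∧ g₂.det ≠ 0 ∧ g₃.det ≠ 0 ∧ g₄.det ≠ 0 ∧ μ ≠ 0 ∧
    IsCanonical fun x y z w =>
      μ * ev q (g₁.mulVec ![1, x]) (g₂.mulVec ![1, y]) (g₃.mulVec ![1, z]) (g₄.mulVec ![1, w])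

theorem Classified.of_act {q : Tensor} {g₁ g₂ g₃ g₄ : Matrix (Fin 2) (Fin 2) ℂ}
    (h : Classified (act q g₁ g₂ g₃ g₄))
    (d₁ : g₁.det ≠ 0) (d₂ : g₂.det ≠ 0) (d₃ : g₃.det ≠ 0) (d₄ : g₄.det ≠ 0) :
    Classified q := by
  obtain ⟨f₁, f₂, f₃, f₄, μ, e₁, e₂, e₃, e₄, hμ, hc⟩ := h
  refine ⟨g₁ * f₁, g₂ * f₂, g₃ * f₃, g₄ * f₄, μ, ?_, ?_, ?_, ?_, hμ, ?_⟩
  iterate 4 rw [Matrix.det_mul]; exact mul_ne_zero ‹_› ‹_›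
  simpa only [ev_act, Matrix.mulVec_mulVec] using hc

/-- The form `p x₁x₂x₃x₄ + r x₁x₂ + s x₃x₄ + a (x₁x₄ + x₂x₃) + b (x₁x₃ + x₂x₄) + u`. -/
def evenForm (p u r s a b : ℂ) : Tensor :=
  ![![![![u, 0], ![0, s]], ![![0, b], ![a, 0]]], ![![![0, a], ![b, 0]], ![![r, 0], ![0, p]]]]

/-- The general affine-linear form of degree at most two. -/
def quadForm (e l₁ l₂ l₃ l₄ r s a a' b b' : ℂ) : Tensor :=
  ![![![![e, l₄], ![l₃, s]], ![![l₂, b'], ![a', 0]]], ![![![l₁, a], ![b, 0]], ![![r, 0], ![0, 0]]]]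

theorem ev_evenForm (p u r s a b : ℂ) (v₁ v₂ v₃ v₄ : Fin 2 → ℂ) :
    ev (evenForm p u r s a b) v₁ v₂ v₃ v₄ =
      p * (v₁ 1 * v₂ 1 * v₃ 1 * v₄ 1) + r * (v₁ 1 * v₂ 1 * v₃ 0 * v₄ 0)
        + s * (v₁ 0 * v₂ 0 * v₃ 1 * v₄ 1)
        + a * (v₁ 1 * v₂ 0 * v₃ 0 * v₄ 1 + v₁ 0 * v₂ 1 * v₃ 1 * v₄ 0)
        + b * (v₁ 1 * v₂ 0 * v₃ 1 * v₄ 0 + v₁ 0 * v₂ 1 * v₃ 0 * v₄ 1)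
        + u * (v₁ 0 * v₂ 0 * v₃ 0 * v₄ 0) := by
  simp [ev, evenForm, Fin.sum_univ_two]; ring

theorem ev_quadForm (e l₁ l₂ l₃ l₄ r s a a' b b' : ℂ) (v₁ v₂ v₃ v₄ : Fin 2 → ℂ) :
    ev (quadForm e l₁ l₂ l₃ l₄ r s a a' b b') v₁ v₂ v₃ v₄ =
      e * (v₁ 0 * v₂ 0 * v₃ 0 * v₄ 0)
        + l₁ * (v₁ 1 * v₂ 0 * v₃ 0 * v₄ 0) + l₂ * (v₁ 0 * v₂ 1 * v₃ 0 * v₄ 0)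
        + l₃ * (v₁ 0 * v₂ 0 * v₃ 1 * v₄ 0) + l₄ * (v₁ 0 * v₂ 0 * v₃ 0 * v₄ 1)
        + r * (v₁ 1 * v₂ 1 * v₃ 0 * v₄ 0) + s * (v₁ 0 * v₂ 0 * v₃ 1 * v₄ 1)
        + a * (v₁ 1 * v₂ 0 * v₃ 0 * v₄ 1) + a' * (v₁ 0 * v₂ 1 * v₃ 1 * v₄ 0)
        + b * (v₁ 1 * v₂ 0 * v₃ 1 * v₄ 0) + b' * (v₁ 0 * v₂ 1 * v₃ 0 * v₄ 1) := by
  simp [ev, quadForm, Fin.sum_univ_two]; ring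

theorem tensor_ext {p q : Tensor}
    (h : ∀ i j k l, p i j k l = q i j k l) : p = q :=
  funext fun i => funext fun j => funext fun k => funext fun l => h i j k l

/-- The substitution `x ↦ c x`. -/
abbrev scale (c : ℂ) : Matrix (Fin 2) (Fin 2) ℂ := !![1, 0; 0, c]

/-- The substitution `x ↦ x + c`. -/
abbrev shift (c : ℂ) : Matrix (Fin 2) (Fin 2) ℂ := !![1, 0; c, 1]

/-- The substitution `x ↦ 1 / x`. -/
abbrev swap : Matrix (Fin 2) (Fin 2) ℂ := !![0, 1; 1, 0]

theorem det_scale {c : ℂ} (hc : c ≠ 0) : (scale c).det ≠ 0 := by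
  simpa [Matrix.det_fin_two] using hc

theorem det_shift (c : ℂ) : (shift c).det ≠ 0 := by
  simp

theorem det_swap : swap.det ≠ 0 := by
  simp [Matrix.det_fin_two]

/-- Forms of type (Q1) are classified. -/
theorem classified_of_sum_eq_zero {u r a b : ℂ} (hr : r ≠ 0) (ha : a ≠ 0) (hb : b ≠ 0)
    (h : r + a + b = 0) : Classified (evenForm 0 u r r a b) := by
  have hb' : b = -(r + a) := by linear_combination h
  have hra : r + a ≠ 0 := fun h' => hb (by rw [hb', h', neg_zero])
  refine ⟨1, 1, 1, 1, 1, by simp, by simp, by simp, by simp, by simp, ?_⟩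
  refine Or.inr (Or.inr (Or.inr ⟨r, a, -u / (r * a * (r + a)), fun x y z w => ?_⟩))
  simp only [ev_evenForm, hb']
  simp
  field_simp
  ring

/-- Forms of type (Q3) or (Q1) are classified. -/
theorem classified_of_quartic_coeff_eq_zero {u r a b : ℂ} (hr : r ≠ 0) (ha : a ≠ 0) (hb : b ≠ 0) :
    Classified (evenForm 0 u r r a b) := by
  by_cases h0 : r + a + b = 0
  · exact classified_of_sum_eq_zero hr ha hb h0
  have d1 := det_scale (one_ne_zero (α := ℂ))
  have d2 := det_scale (neg_ne_zero.2 (one_ne_zero (α := ℂ)))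
  by_cases h1 : r - a - b = 0
  · refine Classified.of_act (g₁ := scale (-1)) (g₂ := scale (-1)) (g₃ := scale 1)
      (g₄ := scale 1) ?_ d2 d2 d1 d1
    have : act (evenForm 0 u r r a b) (scale (-1)) (scale (-1)) (scale 1) (scale 1) =
        evenForm 0 u r r (-a) (-b) := by
      refine tensor_ext fun i j k l => ?_
      rw [act, ev_evenForm]
      fin_cases i <;> fin_cases j <;> fin_cases k <;> fin_cases l <;> simp [evenForm]
    rw [this]
    exact classified_of_sum_eq_zero hr (neg_ne_zero.2 ha) (neg_ne_zero.2 hb)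
      (by linear_combination h1)
  by_cases h2 : r + a - b = 0
  · refine Classified.of_act (g₁ := scale (-1)) (g₂ := scale 1) (g₃ := scale (-1))
      (g₄ := scale 1) ?_ d2 d1 d2 d1
    have : act (evenForm 0 u r r a b) (scale (-1)) (scale 1) (scale (-1)) (scale 1) =
        evenForm 0 u (-r) (-r) (-a) b := by
      refine tensor_ext fun i j k l => ?_
      rw [act, ev_evenForm]
      fin_cases i <;> fin_cases j <;> fin_cases k <;> fin_cases l <;> simp [evenForm]
    rw [this]
    exact classified_of_sum_eq_zero (neg_ne_zero.2 hr) (neg_ne_zero.2 ha) hb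
      (by linear_combination -h2)
  by_cases h3 : r - a + b = 0
  · refine Classified.of_act (g₁ := scale (-1)) (g₂ := scale 1) (g₃ := scale 1)
      (g₄ := scale (-1)) ?_ d2 d1 d1 d2
    have : act (evenForm 0 u r r a b) (scale (-1)) (scale 1) (scale 1) (scale (-1)) =
        evenForm 0 u (-r) (-r) a (-b) := by
      refine tensor_ext fun i j k l => ?_
      rw [act, ev_evenForm]
      fin_cases i <;> fin_cases j <;> fin_cases k <;> fin_cases l <;> simp [evenForm]
    rw [this]
    exact classified_of_sum_eq_zero (neg_ne_zero.2 hr) ha (neg_ne_zero.2 hb)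
      (by linear_combination -h3)
  obtain ⟨ω, hω⟩ := IsAlgClosed.exists_pow_nat_eq
    ((r + a + b) * (r - a - b) * (r - a + b) * (r + a - b)) (n := 2) (by norm_num)
  have hω0 : ω ≠ 0 := by
    rintro rfl
    have : (r + a + b) * (r - a - b) * (r - a + b) * (r + a - b) ≠ 0 := by
      simp [h0, h1, h2, h3]
    exact this (by rw [← hω]; norm_num)
  have hα : (-(a ^ 2 + b ^ 2 - r ^ 2) + ω) * (-(a ^ 2 + b ^ 2 - r ^ 2) - ω) =
    (2 * a * b) ^ 2 := by linear_combination -hω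
  have hβ : (-(r ^ 2 + b ^ 2 - a ^ 2) + ω) * (-(r ^ 2 + b ^ 2 - a ^ 2) - ω) =
    (2 * r * b) ^ 2 := by linear_combination -hω
  have hα0 : (-(a ^ 2 + b ^ 2 - r ^ 2) + ω) ≠ 0 :=
    left_ne_zero_of_mul (hα.trans_ne (by simp [ha, hb]))
  have hβ0 : (-(r ^ 2 + b ^ 2 - a ^ 2) + ω) ≠ 0 :=
    left_ne_zero_of_mul (hβ.trans_ne (by simp [hr, hb]))
  have iα : ((-(a ^ 2 + b ^ 2 - r ^ 2) + ω) / (2 * a * b))⁻¹ =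
      (-(a ^ 2 + b ^ 2 - r ^ 2) - ω) / (2 * a * b) := by
    rw [inv_div, div_eq_div_iff hα0 (by simp [ha, hb])]
    linear_combination -hα
  have iβ : ((-(r ^ 2 + b ^ 2 - a ^ 2) + ω) / (2 * r * b))⁻¹ =
      (-(r ^ 2 + b ^ 2 - a ^ 2) - ω) / (2 * r * b) := by
    rw [inv_div, div_eq_div_iff hβ0 (by simp [hr, hb])]
    linear_combination -hβ
  refine ⟨1, 1, 1, 1, ω / (r * a * b), by simp, by simp, by simp, by simp, by simp [*], ?_⟩
  refine Or.inr (Or.inl ⟨(-(a ^ 2 + b ^ 2 - r ^ 2) + ω) / (2 * a * b),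
    (-(r ^ 2 + b ^ 2 - a ^ 2) + ω) / (2 * r * b), -4 * u * (r * a * b) / ω ^ 2,
    div_ne_zero hα0 (by simp [ha, hb]), div_ne_zero hβ0 (by simp [hr, hb]), fun x y z w => ?_⟩)
  simp only [ev_evenForm, iα, iβ]
  simp
  field_simp
  ring

theorem exists_sqrt (c : ℂ) : ∃ t : ℂ, t ^ 2 = c :=
  IsAlgClosed.exists_pow_nat_eq c (by norm_num)

/-- Forms of type (Q4) are classified. -/
theorem classified_of_sq_ne_sq {p r a b : ℂ} (hp : p ≠ 0) (hr : r ≠ 0) (ha : a ≠ 0) (hb : b ≠ 0)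
    (hpb : p ^ 2 ≠ b ^ 2) : Classified (evenForm p p r r a b) := by
  obtain ⟨t, ht⟩ : ∃ t : ℂ, 4 * p ^ 2 * (t ^ 2) ^ 2
      + ((r ^ 2 + a ^ 2 + b ^ 2 - p ^ 2) ^ 2
        - 4 * (r ^ 2 * a ^ 2 + r ^ 2 * b ^ 2 + a ^ 2 * b ^ 2)) * t ^ 2
      + 4 * r ^ 2 * a ^ 2 * b ^ 2 = 0 := by
    obtain ⟨s, hs⟩ := exists_sqrt (discrim (4 * p ^ 2) ((r ^ 2 + a ^ 2 + b ^ 2 - p ^ 2) ^ 2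
        - 4 * (r ^ 2 * a ^ 2 + r ^ 2 * b ^ 2 + a ^ 2 * b ^ 2)) (4 * r ^ 2 * a ^ 2 * b ^ 2))
    obtain ⟨T, hT⟩ := exists_quadratic_eq_zero (a := 4 * p ^ 2) (by simp [hp])
      ⟨s, by rw [← hs, sq]⟩
    obtain ⟨t, rfl⟩ := exists_sqrt T
    exact ⟨t, by linear_combination hT⟩
  have ht0 : t ≠ 0 := by
    rintro rfl
    have : 4 * r ^ 2 * a ^ 2 * b ^ 2 ≠ 0 := by simp [hr, ha, hb]
    exact this (by linear_combination ht)
  set k := p * t ^ 2 / (r * a * b) with hk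
  have hk0 : k ≠ 0 := by simp [hk, hp, ht0, hr, ha, hb]
  have hD : k ^ 2 * (r / t) ^ 2 * (a / t) ^ 2 = p ^ 2 / b ^ 2 := by
    rw [hk]; field_simp
  have hD1 : k ^ 2 * (r / t) ^ 2 * (a / t) ^ 2 ≠ 1 := by
    rw [hD]
    intro h
    rw [div_eq_one_iff_eq (pow_ne_zero 2 hb)] at h
    exact hpb h
  obtain ⟨A, hA⟩ := exists_sqrt (((r / t) ^ 2 - 1) * (k ^ 2 * (r / t) ^ 2 - 1))
  obtain ⟨B, hB⟩ := exists_sqrt (((a / t) ^ 2 - 1) * (k ^ 2 * (a / t) ^ 2 - 1))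
  obtain ⟨A', B', hA', hB', hAB⟩ : ∃ A' B' : ℂ,
      A' ^ 2 = ((r / t) ^ 2 - 1) * (k ^ 2 * (r / t) ^ 2 - 1) ∧
      B' ^ 2 = ((a / t) ^ 2 - 1) * (k ^ 2 * (a / t) ^ 2 - 1) ∧
      r / t * B' + a / t * A' = b / t * (k ^ 2 * (r / t) ^ 2 * (a / t) ^ 2 - 1) := by
    have key : ((b / t * (p ^ 2 / b ^ 2 - 1)) ^ 2
          - (r / t) ^ 2 * (((a / t) ^ 2 - 1) * (k ^ 2 * (a / t) ^ 2 - 1))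
          - (a / t) ^ 2 * (((r / t) ^ 2 - 1) * (k ^ 2 * (r / t) ^ 2 - 1))) ^ 2
        = 4 * (r / t) ^ 2 * (a / t) ^ 2 * (((a / t) ^ 2 - 1) * (k ^ 2 * (a / t) ^ 2 - 1))
          * (((r / t) ^ 2 - 1) * (k ^ 2 * (r / t) ^ 2 - 1)) := by
      have e1 : (b / t * (p ^ 2 / b ^ 2 - 1)) ^ 2 =
          t ^ 2 * (p ^ 2 - b ^ 2) ^ 2 / (t ^ 4 * b ^ 2) := by field_simp
      have e2 : (r / t) ^ 2 * (((a / t) ^ 2 - 1) * (k ^ 2 * (a / t) ^ 2 - 1)) =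
          (a ^ 2 - t ^ 2) * (p ^ 2 * t ^ 2 - r ^ 2 * b ^ 2) / (t ^ 4 * b ^ 2) := by
        rw [hk]; field_simp
      have e3 : (a / t) ^ 2 * (((r / t) ^ 2 - 1) * (k ^ 2 * (r / t) ^ 2 - 1)) =
          (r ^ 2 - t ^ 2) * (p ^ 2 * t ^ 2 - a ^ 2 * b ^ 2) / (t ^ 4 * b ^ 2) := by
        rw [hk]; field_simp
      have e4 : 4 * (r / t) ^ 2 * (a / t) ^ 2 * (((a / t) ^ 2 - 1) * (k ^ 2 * (a / t) ^ 2 - 1))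
          * (((r / t) ^ 2 - 1) * (k ^ 2 * (r / t) ^ 2 - 1)) =
          4 * ((r / t) ^ 2 * (((a / t) ^ 2 - 1) * (k ^ 2 * (a / t) ^ 2 - 1))) *
            ((a / t) ^ 2 * (((r / t) ^ 2 - 1) * (k ^ 2 * (r / t) ^ 2 - 1))) := by ring
      have hdiv : ∀ x y z W : ℂ, (x - y - z) ^ 2 = 4 * y * z →
          (x / W - y / W - z / W) ^ 2 = 4 * (y / W) * (z / W) := by
        intro x y z W h
        linear_combination (1 / W ^ 2) * h
      rw [e4, e1, e2, e3]
      refine hdiv _ _ _ _ ?_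
      linear_combination t ^ 2 * (p ^ 2 - b ^ 2) ^ 2 * ht
    rw [← hA, ← hB] at key
    have hfac : ((b / t * (p ^ 2 / b ^ 2 - 1)) - r / t * B - a / t * A)
        * ((b / t * (p ^ 2 / b ^ 2 - 1)) - r / t * B + a / t * A)
        * ((b / t * (p ^ 2 / b ^ 2 - 1)) + r / t * B - a / t * A)
        * ((b / t * (p ^ 2 / b ^ 2 - 1)) + r / t * B + a / t * A) = 0 := by
      linear_combination key
    rw [hD]
    rcases mul_eq_zero.1 hfac with h | h
    · rcases mul_eq_zero.1 h with h | h
      · rcases mul_eq_zero.1 h with h | h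
        · exact ⟨A, B, hA, hB, by linear_combination -h⟩
        · exact ⟨-A, B, by rw [neg_sq, hA], hB, by linear_combination -h⟩
      · exact ⟨A, -B, hA, by rw [neg_sq, hB], by linear_combination -h⟩
    · exact ⟨-A, -B, by rw [neg_sq, hA], by rw [neg_sq, hB], by linear_combination -h⟩
  obtain ⟨c, hc⟩ := exists_sqrt k
  have hc0 : c ≠ 0 := by rintro rfl; exact hk0 (by rw [← hc]; norm_num)
  refine ⟨scale c, scale c, scale c, scale c, 1 / (k * t), det_scale hc0, det_scale hc0,
    det_scale hc0, det_scale hc0, by simp [hk0, ht0], ?_⟩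
  refine Or.inl ⟨k, r / t, a / t, A', B', hA', hB', hD1, fun x y z w => ?_⟩
  rw [hAB, mul_div_cancel_right₀ _ (sub_ne_zero.2 hD1)]
  have hprod : r / t * (a / t) * (b / t) = p / (k * t) := by
    rw [hk]; field_simp
  have hc4 : c * c * c * c = k ^ 2 := by rw [← hc]; ring
  rw [hprod]
  simp only [ev_evenForm]
  simp
  field_simp
  rw [← hc]
  ring

theorem typeQ_evenForm {p u r s a b : ℂ} (h : TypeQ (evenForm p u r s a b)) :
    (a * b ≠ 0 ∨ s * u ≠ 0) ∧ (a * b ≠ 0 ∨ p * r ≠ 0) ∧ (a * b ≠ 0 ∨ r * u ≠ 0) ∧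
    (a * b ≠ 0 ∨ p * s ≠ 0) ∧ (b * s ≠ 0 ∨ a * u ≠ 0) ∧ (r * b ≠ 0 ∨ p * a ≠ 0) ∧
    (r * b ≠ 0 ∨ a * u ≠ 0) ∧ (b * s ≠ 0 ∨ p * a ≠ 0) := by
  have ne0 : (![1, 0] : Fin 2 → ℂ) ≠ 0 := fun h => by simpa using congrFun h 0
  have ne1 : (![0, 1] : Fin 2 → ℂ) ≠ 0 := fun h => by simpa using congrFun h 1
  obtain ⟨v1, e1⟩ := h.n12.1 _ ne0
  obtain ⟨v2, e2⟩ := h.n12.1 _ ne1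
  obtain ⟨v3, e3⟩ := h.n34.1 _ ne0
  obtain ⟨v4, e4⟩ := h.n34.1 _ ne1
  obtain ⟨v5, e5⟩ := h.n14.1 _ ne0
  obtain ⟨v6, e6⟩ := h.n14.1 _ ne1
  obtain ⟨v7, e7⟩ := h.n14.2 _ ne0
  obtain ⟨v8, e8⟩ := h.n14.2 _ ne1
  refine ⟨?_, ?_, ?_, ?_, ?_, ?_, ?_, ?_⟩
  · contrapose! e1
    simp [h12, det22, ev_evenForm]
    linear_combination v1 1 ^ 2 * e1.1 - v1 0 ^ 2 * e1.2
  · contrapose! e2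
    simp [h12, det22, ev_evenForm]
    linear_combination v2 0 ^ 2 * e2.1 - v2 1 ^ 2 * e2.2
  · contrapose! e3
    simp [h34, det22, ev_evenForm]
    linear_combination v3 1 ^ 2 * e3.1 - v3 0 ^ 2 * e3.2
  · contrapose! e4
    simp [h34, det22, ev_evenForm]
    linear_combination v4 0 ^ 2 * e4.1 - v4 1 ^ 2 * e4.2
  · contrapose! e5
    simp [h14, det22, ev_evenForm]
    linear_combination v5 1 ^ 2 * e5.1 - v5 0 ^ 2 * e5.2
  · contrapose! e6
    simp [h14, det22, ev_evenForm]
    linear_combination v6 0 ^ 2 * e6.1 - v6 1 ^ 2 * e6.2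
  · contrapose! e7
    simp [h14, det22, ev_evenForm]
    linear_combination v7 1 ^ 2 * e7.1 - v7 0 ^ 2 * e7.2
  · contrapose! e8
    simp [h14, det22, ev_evenForm]
    linear_combination v8 0 ^ 2 * e8.1 - v8 1 ^ 2 * e8.2

/-- If `p² = b²`, `r² = a²`, some edge biquadratic of the symmetric form has a factor. -/
theorem typeQ_evenForm_sq {p r a b : ℂ} (h : TypeQ (evenForm p p r r a b)) (hpb : p ^ 2 = b ^ 2)
    (hp : p ≠ 0) (hr : r ≠ 0) (hra : r ^ 2 = a ^ 2) : False := by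
  have hb : b ≠ 0 := by
    rintro rfl; exact hp (by simpa using hpb)
  have ha : a ≠ 0 := by
    rintro rfl; exact hr (by simpa using hra)
  obtain ⟨c, hc⟩ := exists_sqrt (a * b / (p * r))
  have hc2 : p * r * c ^ 2 = a * b := by rw [hc]; field_simp
  have hc4 : c ^ 4 = 1 := by
    have : (p * r) ^ 2 * (c ^ 4 - 1) = 0 := by
      linear_combination (p * r * c ^ 2 + a * b) * hc2 - a ^ 2 * hpb - p ^ 2 * hra
    rcases mul_eq_zero.1 this with h | h
    · simp [hp, hr] at h
    · linear_combination h
  obtain ⟨v, hv⟩ := h.n12.1 ![1, c] fun h => by simpa using congrFun h 0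
  apply hv
  simp [h12, det22, ev_evenForm]
  have e : p * r = a * b * c ^ 2 := by
    linear_combination (-p * r) * hc4 + c ^ 2 * hc2
  linear_combination -v 1 ^ 2 * hc2 - v 0 ^ 2 * e - c * v 0 * v 1 * (hpb + hra)

theorem classified_symm_evenForm {p r a b : ℂ} (h : TypeQ (evenForm p p r r a b)) (hp : p ≠ 0) :
    Classified (evenForm p p r r a b) := by
  have d1 := det_scale (one_ne_zero (α := ℂ))
  obtain ⟨c1, -, -, -, c2, c3, -, -⟩ := typeQ_evenForm h
  by_cases hr : r = 0
  · subst hr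
    have ha : a ≠ 0 := by rintro rfl; simp at c1
    have hb : b ≠ 0 := by rintro rfl; simp at c1
    refine Classified.of_act (g₁ := swap) (g₂ := swap) (g₃ := scale 1)
      (g₄ := scale 1) ?_ det_swap det_swap d1 d1
    have : act (evenForm p p 0 0 a b) swap swap (scale 1) (scale 1) =
        evenForm 0 0 p p b a := by
      refine tensor_ext fun i j k l => ?_
      rw [act, ev_evenForm]
      fin_cases i <;> fin_cases j <;> fin_cases k <;> fin_cases l <;> simp [evenForm]
    rw [this]
    exact classified_of_quartic_coeff_eq_zero hp hb ha
  by_cases ha : a = 0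
  · subst ha
    have hb : b ≠ 0 := by rintro rfl; simp at c2
    refine Classified.of_act (g₁ := swap) (g₂ := scale 1) (g₃ := scale 1)
      (g₄ := swap) ?_ det_swap d1 d1 det_swap
    have : act (evenForm p p r r 0 b) swap (scale 1) (scale 1) swap =
        evenForm 0 0 b b p r := by
      refine tensor_ext fun i j k l => ?_
      rw [act, ev_evenForm]
      fin_cases i <;> fin_cases j <;> fin_cases k <;> fin_cases l <;> simp [evenForm]
    rw [this]
    exact classified_of_quartic_coeff_eq_zero hb hp hr
  by_cases hb : b = 0
  · subst hb
    refine Classified.of_act (g₁ := swap) (g₂ := scale 1) (g₃ := swap)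
      (g₄ := scale 1) ?_ det_swap d1 det_swap d1
    have : act (evenForm p p r r a 0) swap (scale 1) swap (scale 1) =
        evenForm 0 0 a a r p := by
      refine tensor_ext fun i j k l => ?_
      rw [act, ev_evenForm]
      fin_cases i <;> fin_cases j <;> fin_cases k <;> fin_cases l <;> simp [evenForm]
    rw [this]
    exact classified_of_quartic_coeff_eq_zero ha hr hp
  by_cases hpb : p ^ 2 = b ^ 2
  · refine Classified.of_act (g₁ := swap) (g₂ := swap) (g₃ := scale 1)
      (g₄ := scale 1) ?_ det_swap det_swap d1 d1
    have : act (evenForm p p r r a b) swap swap (scale 1) (scale 1) =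
        evenForm r r p p b a := by
      refine tensor_ext fun i j k l => ?_
      rw [act, ev_evenForm]
      fin_cases i <;> fin_cases j <;> fin_cases k <;> fin_cases l <;> simp [evenForm]
    rw [this]
    exact classified_of_sq_ne_sq hr hp hb ha fun hra => typeQ_evenForm_sq h hpb hp hr hra
  · exact classified_of_sq_ne_sq hp hr ha hb hpb

theorem act_scale_evenForm (c d p u r s a b : ℂ) (hcd : c * d = 1) :
    act (evenForm p u r s a b) (scale c) (scale c) (scale d) (scale d) =
      evenForm p u (c ^ 2 * r) (d ^ 2 * s) a b := by
  have h2 : c * c * d * d = 1 := by linear_combination (c * d + 1) * hcd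
  refine tensor_ext fun i j k l => ?_
  rw [act, ev_evenForm]
  fin_cases i <;> fin_cases j <;> fin_cases k <;> fin_cases l <;>
    simp [evenForm, hcd, h2] <;> ring

theorem classified_evenForm_of_ne_zero {p u r s a b : ℂ} (h : TypeQ (evenForm p u r s a b))
    (hr : r ≠ 0) (hs : s ≠ 0) : Classified (evenForm p u r s a b) := by
  wlog hrs : r = s generalizing r s
  · obtain ⟨c, hc⟩ := IsAlgClosed.exists_pow_nat_eq (s / r) (n := 4) (by norm_num)
    have hc0 : c ≠ 0 := by
      rintro rfl
      exact div_ne_zero hs hr (by rw [← hc]; norm_num)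
    have d1 := det_scale hc0
    have d2 := det_scale (inv_ne_zero hc0)
    refine Classified.of_act (g₁ := scale c) (g₂ := scale c) (g₃ := scale c⁻¹)
      (g₄ := scale c⁻¹) ?_ d1 d1 d2 d2
    have h' := h.act d1 d1 d2 d2
    rw [act_scale_evenForm _ _ _ _ _ _ _ _ (mul_inv_cancel₀ hc0)] at h' ⊢
    refine this h' (by simp [hc0, hr]) (by simp [hc0, hs]) ?_
    have : c ^ 4 * r = s := by rw [hc]; field_simp
    rw [← this]
    field_simp
  subst hrs
  obtain ⟨c1, c2, c3, c4, c5, c6, c7, c8⟩ := typeQ_evenForm h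
  by_cases hp : p = 0
  · subst hp
    have ha : a ≠ 0 := by rintro rfl; simp at c2
    have hb : b ≠ 0 := by rintro rfl; simp at c2
    exact classified_of_quartic_coeff_eq_zero hr ha hb
  by_cases hu : u = 0
  · subst hu
    have ha : a ≠ 0 := by rintro rfl; simp at c1
    have hb : b ≠ 0 := by rintro rfl; simp at c1
    refine Classified.of_act (g₁ := swap) (g₂ := swap) (g₃ := swap)
      (g₄ := swap) ?_ det_swap det_swap det_swap det_swap
    have : act (evenForm p 0 r r a b) swap swap swap swap =
        evenForm 0 p r r a b := by
      refine tensor_ext fun i j k l => ?_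
      rw [act, ev_evenForm]
      fin_cases i <;> fin_cases j <;> fin_cases k <;> fin_cases l <;> simp [evenForm]
    rw [this]
    exact classified_of_quartic_coeff_eq_zero hr ha hb
  obtain ⟨c, hc⟩ := IsAlgClosed.exists_pow_nat_eq (u / p) (n := 4) (by norm_num)
  have hc0 : c ≠ 0 := by
    rintro rfl
    exact div_ne_zero hu hp (by rw [← hc]; norm_num)
  have d1 := det_scale hc0
  refine Classified.of_act (g₁ := scale c) (g₂ := scale c) (g₃ := scale c)
    (g₄ := scale c) ?_ d1 d1 d1 d1
  have h' := h.act d1 d1 d1 d1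
  have e : act (evenForm p u r r a b) (scale c) (scale c) (scale c) (scale c) =
      evenForm u u (c ^ 2 * r) (c ^ 2 * r) (c ^ 2 * a) (c ^ 2 * b) := by
    have hcu : p * c ^ 4 = u := by rw [hc]; field_simp
    rw [← hcu]
    refine tensor_ext fun i j k l => ?_
    rw [act, ev_evenForm]
    fin_cases i <;> fin_cases j <;> fin_cases k <;> fin_cases l <;>
      simp [evenForm, -mul_eq_mul_left_iff] <;> ring
  rw [e] at h' ⊢
  exact classified_symm_evenForm h' hu

theorem classified_evenForm {p u r s a b : ℂ} (h : TypeQ (evenForm p u r s a b)) :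
    Classified (evenForm p u r s a b) := by
  by_cases hrs : r ≠ 0 ∧ s ≠ 0
  · exact classified_evenForm_of_ne_zero h hrs.1 hrs.2
  have d1 := det_scale (one_ne_zero (α := ℂ))
  have e : act (evenForm p u r s a b) (scale 1) (scale 1) swap swap =
      evenForm r s p u b a := by
    refine tensor_ext fun i j k l => ?_
    rw [act, ev_evenForm]
    fin_cases i <;> fin_cases j <;> fin_cases k <;> fin_cases l <;> simp [evenForm]
  have h' := h.act d1 d1 det_swap det_swap
  refine Classified.of_act (g₁ := scale 1) (g₂ := scale 1) (g₃ := swap)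
    (g₄ := swap) ?_ d1 d1 det_swap det_swap
  rw [e] at h' ⊢
  obtain ⟨c1, c2, c3, c4, c5, c6, c7, c8⟩ := typeQ_evenForm h
  refine classified_evenForm_of_ne_zero h' ?_ ?_
  · rintro rfl
    apply hrs
    simp_all
  · rintro rfl
    apply hrs
    simp_all

/-- Forms of type (Q2) are classified. -/
theorem classified_quadForm_of_sum_eq_zero {e l r a b : ℂ} (hl : l ≠ 0) (hr : r ≠ 0) (ha : a ≠ 0)
    (hb : b ≠ 0) (h : r + a + b = 0) : Classified (quadForm e l l l l r r a a b b) := by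
  obtain ⟨s, hs⟩ : ∃ s, s = l / (r * a * b) := ⟨_, rfl⟩
  have hs0 : s ≠ 0 := by simp [hs, hl, hr, ha, hb]
  have hls : l = s * (r * a * b) := by rw [hs]; field_simp
  obtain ⟨c, hc⟩ : ∃ c, 4 * l * c = s ^ 2 * (r * a * (r + a) * (r ^ 2 + r * a + a ^ 2)) - e :=
    ⟨(s ^ 2 * (r * a * (r + a) * (r ^ 2 + r * a + a ^ 2)) - e) / (4 * l), by field_simp⟩
  have hd : (!![1, 0; c, s] : Matrix (Fin 2) (Fin 2) ℂ).det ≠ 0 := by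
    simpa [Matrix.det_fin_two] using hs0
  refine ⟨!![1, 0; c, s], !![1, 0; c, s], !![1, 0; c, s], !![1, 0; c, s], 1 / s ^ 2,
    hd, hd, hd, hd, by simp [hs0], ?_⟩
  refine Or.inr (Or.inr (Or.inl ⟨r, a, fun x y z w => ?_⟩))
  have hb' : b = -(r + a) := by linear_combination h
  beta_reduce
  rw [ev_quadForm, div_mul_eq_mul_div, one_mul, div_eq_iff (pow_ne_zero 2 hs0)]
  simp
  subst hb'
  linear_combination hc + (s * (x + y + z + w)) * hls

theorem act_shift_quadForm (e l₁ l₂ l₃ l₄ r a b c₁ c₂ c₃ c₄ : ℂ) :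
    act (quadForm e l₁ l₂ l₃ l₄ r r a a b b) (shift c₁) (shift c₂) (shift c₃) (shift c₄) =
      quadForm (e + l₁ * c₁ + l₂ * c₂ + l₃ * c₃ + l₄ * c₄ + r * (c₁ * c₂ + c₃ * c₄)
          + a * (c₁ * c₄ + c₂ * c₃) + b * (c₁ * c₃ + c₂ * c₄))
        (l₁ + r * c₂ + a * c₄ + b * c₃) (l₂ + r * c₁ + a * c₃ + b * c₄)
        (l₃ + r * c₄ + a * c₂ + b * c₁) (l₄ + r * c₃ + a * c₁ + b * c₂) r r a a b b := by
  refine tensor_ext fun i j k l => ?_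
  rw [act, ev_quadForm]
  fin_cases i <;> fin_cases j <;> fin_cases k <;> fin_cases l <;> simp [quadForm] <;> ring

theorem classified_quadForm_aux {e l₁ l₂ l₃ l₄ r a b : ℂ} (hr : r ≠ 0) (ha : a ≠ 0) (hb : b ≠ 0)
    (h₁ : r - a - b ≠ 0) (h₂ : a - r - b ≠ 0) (h₃ : b - r - a ≠ 0) :
    Classified (quadForm e l₁ l₂ l₃ l₄ r r a a b b) := by
  have key : ∀ t : ℂ, ∃ c₁ c₂ c₃ c₄ l, l = (l₁ + l₂ + l₃ + l₄ + (r + a + b) * t) / 4 ∧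
      l₁ + r * c₂ + a * c₄ + b * c₃ = l ∧ l₂ + r * c₁ + a * c₃ + b * c₄ = l ∧
      l₃ + r * c₄ + a * c₂ + b * c₁ = l ∧ l₄ + r * c₃ + a * c₁ + b * c₂ = l := by
    intro t
    obtain ⟨t₁, e₁⟩ : ∃ t₁, (r - a - b) * t₁ = -(l₁ + l₂ - l₃ - l₄) :=
      ⟨_, mul_div_cancel₀ _ h₁⟩
    obtain ⟨t₂, e₂⟩ : ∃ t₂, (a - r - b) * t₂ = -(l₁ - l₂ - l₃ + l₄) :=
      ⟨_, mul_div_cancel₀ _ h₂⟩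
    obtain ⟨t₃, e₃⟩ : ∃ t₃, (b - r - a) * t₃ = -(l₁ - l₂ + l₃ - l₄) :=
      ⟨_, mul_div_cancel₀ _ h₃⟩
    refine ⟨(t + t₁ + t₂ + t₃) / 4, (t + t₁ - t₂ - t₃) / 4, (t - t₁ - t₂ + t₃) / 4,
      (t - t₁ + t₂ - t₃) / 4, _, rfl, ?_, ?_, ?_, ?_⟩
    · linear_combination (e₁ + e₂ + e₃) / 4
    · linear_combination (e₁ - e₂ - e₃) / 4
    · linear_combination (-e₁ - e₂ + e₃) / 4
    · linear_combination (-e₁ + e₂ - e₃) / 4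
  have hzero : ∀ e, Classified (quadForm e 0 0 0 0 r r a a b b) := fun e =>
    classified_of_quartic_coeff_eq_zero (u := e) hr ha hb
  by_cases h₀ : r + a + b = 0
  · obtain ⟨c₁, c₂, c₃, c₄, l, -, e₁, e₂, e₃, e₄⟩ := key 0
    refine Classified.of_act (g₁ := shift c₁) (g₂ := shift c₂) (g₃ := shift c₃) (g₄ := shift c₄)
      ?_ (det_shift _) (det_shift _) (det_shift _) (det_shift _)
    rw [act_shift_quadForm, e₁, e₂, e₃, e₄]
    by_cases hl : l = 0
    · subst hl
      exact hzero _
    · exact classified_quadForm_of_sum_eq_zero hl hr ha hb h₀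
  · obtain ⟨c₁, c₂, c₃, c₄, l, hl, e₁, e₂, e₃, e₄⟩ :=
      key (-(l₁ + l₂ + l₃ + l₄) / (r + a + b))
    have hl0 : l = 0 := by rw [hl, mul_div_cancel₀ _ h₀]; ring
    refine Classified.of_act (g₁ := shift c₁) (g₂ := shift c₂) (g₃ := shift c₃) (g₄ := shift c₄)
      ?_ (det_shift _) (det_shift _) (det_shift _) (det_shift _)
    rw [act_shift_quadForm, e₁, e₂, e₃, e₄, hl0]
    exact hzero _

theorem classified_symm_quadForm {e l₁ l₂ l₃ l₄ r a b : ℂ} (hr : r ≠ 0) (ha : a ≠ 0)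
    (hb : b ≠ 0) : Classified (quadForm e l₁ l₂ l₃ l₄ r r a a b b) := by
  have d1 := det_scale (one_ne_zero (α := ℂ))
  have d2 := det_scale (neg_ne_zero.2 (one_ne_zero (α := ℂ)))
  have two : ∀ {x : ℂ}, x ≠ 0 → 2 * x ≠ 0 := fun hx => mul_ne_zero two_ne_zero hx
  by_cases h₁ : r - a - b = 0
  · refine Classified.of_act (g₁ := scale (-1)) (g₂ := scale (-1)) (g₃ := scale 1)
      (g₄ := scale 1) ?_ d2 d2 d1 d1
    have : act (quadForm e l₁ l₂ l₃ l₄ r r a a b b) (scale (-1)) (scale (-1)) (scale 1)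
        (scale 1) = quadForm e (-l₁) (-l₂) l₃ l₄ r r (-a) (-a) (-b) (-b) := by
      refine tensor_ext fun i j k l => ?_
      rw [act, ev_quadForm]
      fin_cases i <;> fin_cases j <;> fin_cases k <;> fin_cases l <;> simp [quadForm]
    rw [this]
    refine classified_quadForm_aux hr (neg_ne_zero.2 ha) (neg_ne_zero.2 hb)
      (fun h => two hr ?_) (fun h => two ha ?_) (fun h => two hb ?_)
    · linear_combination h + h₁
    · linear_combination -h - h₁
    · linear_combination -h - h₁
  by_cases h₂ : a - r - b = 0
  · refine Classified.of_act (g₁ := scale (-1)) (g₂ := scale 1) (g₃ := scale 1)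
      (g₄ := scale (-1)) ?_ d2 d1 d1 d2
    have : act (quadForm e l₁ l₂ l₃ l₄ r r a a b b) (scale (-1)) (scale 1) (scale 1)
        (scale (-1)) = quadForm e (-l₁) l₂ l₃ (-l₄) (-r) (-r) a a (-b) (-b) := by
      refine tensor_ext fun i j k l => ?_
      rw [act, ev_quadForm]
      fin_cases i <;> fin_cases j <;> fin_cases k <;> fin_cases l <;> simp [quadForm]
    rw [this]
    refine classified_quadForm_aux (neg_ne_zero.2 hr) ha (neg_ne_zero.2 hb)
      (fun h => two hr ?_) (fun h => two ha ?_) (fun h => two hb ?_)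
    · linear_combination -h - h₂
    · linear_combination h + h₂
    · linear_combination -h - h₂
  by_cases h₃ : b - r - a = 0
  · refine Classified.of_act (g₁ := scale (-1)) (g₂ := scale 1) (g₃ := scale (-1))
      (g₄ := scale 1) ?_ d2 d1 d2 d1
    have : act (quadForm e l₁ l₂ l₃ l₄ r r a a b b) (scale (-1)) (scale 1) (scale (-1))
        (scale 1) = quadForm e (-l₁) l₂ (-l₃) l₄ (-r) (-r) (-a) (-a) b b := by
      refine tensor_ext fun i j k l => ?_
      rw [act, ev_quadForm]
      fin_cases i <;> fin_cases j <;> fin_cases k <;> fin_cases l <;> simp [quadForm]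
    rw [this]
    refine classified_quadForm_aux (neg_ne_zero.2 hr) (neg_ne_zero.2 ha) hb
      (fun h => two hr ?_) (fun h => two ha ?_) (fun h => two hb ?_)
    · linear_combination -h - h₃
    · linear_combination -h - h₃
    · linear_combination h + h₃
  exact classified_quadForm_aux hr ha hb h₁ h₂ h₃

theorem typeQ_quadForm {e l₁ l₂ l₃ l₄ r s a a' b b' : ℂ}
    (h : TypeQ (quadForm e l₁ l₂ l₃ l₄ r s a a' b b')) :
    a * b ≠ 0 ∧ a' * b' ≠ 0 ∧ r * b ≠ 0 ∧ s * b' ≠ 0 := by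
  have ne1 : (![0, 1] : Fin 2 → ℂ) ≠ 0 := fun h => by simpa using congrFun h 1
  obtain ⟨v1, e1⟩ := h.n12.1 _ ne1
  obtain ⟨v2, e2⟩ := h.n12.2 _ ne1
  obtain ⟨v3, e3⟩ := h.n14.1 _ ne1
  obtain ⟨v4, e4⟩ := h.n14.2 _ ne1
  refine ⟨?_, ?_, ?_, ?_⟩
  · contrapose! e1
    simp [h12, det22, ev_quadForm, -mul_eq_zero]
    linear_combination v1 0 ^ 2 * e1
  · contrapose! e2
    simp [h12, det22, ev_quadForm, -mul_eq_zero]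
    linear_combination v2 0 ^ 2 * e2
  · contrapose! e3
    simp [h14, det22, ev_quadForm, -mul_eq_zero]
    linear_combination v3 0 ^ 2 * e3
  · contrapose! e4
    simp [h14, det22, ev_quadForm, -mul_eq_zero]
    linear_combination v4 0 ^ 2 * e4

theorem classified_quadForm {e l₁ l₂ l₃ l₄ r s a a' b b' : ℂ}
    (h : TypeQ (quadForm e l₁ l₂ l₃ l₄ r s a a' b b')) :
    Classified (quadForm e l₁ l₂ l₃ l₄ r s a a' b b') := by
  obtain ⟨c1, c2, c3, c4⟩ := typeQ_quadForm h
  obtain ⟨ha, hb⟩ := mul_ne_zero_iff.1 c1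
  obtain ⟨ha', hb'⟩ := mul_ne_zero_iff.1 c2
  have hr := left_ne_zero_of_mul c3
  have hs := left_ne_zero_of_mul c4
  obtain ⟨x, hx⟩ := exists_sqrt (s * b' / (r * b))
  obtain ⟨y, hy⟩ := exists_sqrt (s * a / (r * a'))
  have hx0 : x ≠ 0 := by
    rintro rfl
    exact div_ne_zero c4 c3 (by rw [← hx]; norm_num)
  have hy0 : y ≠ 0 := by
    rintro rfl
    exact div_ne_zero (mul_ne_zero hs ha) (mul_ne_zero hr ha') (by rw [← hy]; norm_num)
  have hz0 : x * y * (r / s) ≠ 0 := by simp [hx0, hy0, hr, hs]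
  have hx' : r * b * x ^ 2 = s * b' := by rw [hx]; field_simp
  have hy' : r * a' * y ^ 2 = s * a := by rw [hy]; field_simp
  refine Classified.of_act (g₁ := scale x) (g₂ := scale y) (g₃ := scale (x * y * (r / s)))
    (g₄ := scale 1) ?_ (det_scale hx0) (det_scale hy0) (det_scale hz0)
    (det_scale one_ne_zero)
  have e : act (quadForm e l₁ l₂ l₃ l₄ r s a a' b b') (scale x) (scale y)
      (scale (x * y * (r / s))) (scale 1) =
      quadForm e (x * l₁) (y * l₂) (x * y * (r / s) * l₃) l₄ (x * y * r) (x * y * r)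
        (x * a) (x * a) (y * b') (y * b') := by
    refine tensor_ext fun i j k l => ?_
    rw [act, ev_quadForm]
    fin_cases i <;> fin_cases j <;> fin_cases k <;> fin_cases l <;>
      simp [quadForm, -mul_eq_mul_left_iff] <;> field_simp
    · linear_combination hy'
    · linear_combination hx'
  rw [e]
  exact classified_symm_quadForm (by simp [*]) (by simp [*]) (by simp [*])

theorem exists_matrix_snd_col {e : Fin 2 → ℂ} (he : e ≠ 0) :
    ∃ g : Matrix (Fin 2) (Fin 2) ℂ, g.det ≠ 0 ∧ g 0 1 = e 0 ∧ g 1 1 = e 1 := by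
  by_cases h0 : e 0 = 0
  · refine ⟨!![1, e 0; 0, e 1], ?_, rfl, rfl⟩
    have h1 : e 1 ≠ 0 := fun h1 => he (by ext k; fin_cases k <;> simp [h0, h1])
    simpa [Matrix.det_fin_two] using h1
  · exact ⟨!![0, e 0; 1, e 1], by simpa [Matrix.det_fin_two] using h0, rfl, rfl⟩

theorem classified_of_vanishing {q : Tensor} (hq : TypeQ q)
    (h₁ : q 1 1 1 1 = 0) (h₂ : q 1 1 1 0 = 0) (h₃ : q 1 1 0 1 = 0) (h₄ : q 1 0 1 1 = 0)
    (h₅ : q 0 1 1 1 = 0) : Classified q := by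
  have : q = quadForm (q 0 0 0 0) (q 1 0 0 0) (q 0 1 0 0) (q 0 0 1 0) (q 0 0 0 1) (q 1 1 0 0)
      (q 0 0 1 1) (q 1 0 0 1) (q 0 1 1 0) (q 1 0 1 0) (q 0 1 0 1) := by
    refine tensor_ext fun i j k l => ?_
    fin_cases i <;> fin_cases j <;> fin_cases k <;> fin_cases l <;> simp [quadForm, *]
  rw [this] at hq ⊢
  exact classified_quadForm hq

/-- A pair of decomposable tensors `e ⊗ f`, `g ⊗ h` exchanged by `q` up to the duality given by
the determinant. -/
theorem classified_of_decomposable {q : Tensor} (hq : TypeQ q) {e f g h : Fin 2 → ℂ}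
    (he : e ≠ 0) (hf : f ≠ 0) (hg : g ≠ 0) (hh : h ≠ 0) {σ σ' : ℂ}
    (h₁ : ∀ w z, ev q e f w z = σ * ((g 0 * w 1 - g 1 * w 0) * (h 0 * z 1 - h 1 * z 0)))
    (h₂ : ∀ u v, ev q u v g h = σ' * ((e 0 * u 1 - e 1 * u 0) * (f 0 * v 1 - f 1 * v 0))) :
    Classified q := by
  obtain ⟨a, da, a0, a1⟩ := exists_matrix_snd_col he
  obtain ⟨b, db, b0, b1⟩ := exists_matrix_snd_col hf
  obtain ⟨c, dc, c0, c1⟩ := exists_matrix_snd_col hg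
  obtain ⟨d, dd', d0, d1⟩ := exists_matrix_snd_col hh
  have col : ∀ {a : Matrix (Fin 2) (Fin 2) ℂ} {e : Fin 2 → ℂ}, a 0 1 = e 0 → a 1 1 = e 1 →
      (fun m => a m 1) = e := by
    intro a e h0 h1
    ext m
    fin_cases m
    exacts [h0, h1]
  refine Classified.of_act (classified_of_vanishing (hq.act da db dc dd') ?_ ?_ ?_ ?_ ?_)
    da db dc dd'
  · rw [act, col a0 a1, col b0 b1, h₁, c0, c1]; ring
  · rw [act, col a0 a1, col b0 b1, h₁, c0, c1]; ring
  · rw [act, col a0 a1, col b0 b1, h₁, d0, d1]; ring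
  · rw [act, col c0 c1, col d0 d1, h₂, a0, a1]; ring
  · rw [act, col c0 c1, col d0 d1, h₂, b0, b1]; ring

/-- The adjugate-type duality on `ℂ² ⊗ ℂ²`. -/
def kap (Y : Matrix (Fin 2) (Fin 2) ℂ) : Matrix (Fin 2) (Fin 2) ℂ :=
  !![Y 1 1, -Y 1 0; -Y 0 1, Y 0 0]

/-- `X` and `Y` form a pair of singular vectors of `q : (ℂ² ⊗ ℂ²) × (ℂ² ⊗ ℂ²) → ℂ`. -/
def IsPair (q : Tensor) (X Y : Matrix (Fin 2) (Fin 2) ℂ) (σ σ' : ℂ) : Prop :=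
  (∀ k l, X 0 0 * q 0 0 k l + X 0 1 * q 0 1 k l + X 1 0 * q 1 0 k l + X 1 1 * q 1 1 k l =
    σ * kap Y k l) ∧
  (∀ i j, q i j 0 0 * Y 0 0 + q i j 0 1 * Y 0 1 + q i j 1 0 * Y 1 0 + q i j 1 1 * Y 1 1 =
    σ' * kap X i j)

theorem exists_vecMulVec {X : Matrix (Fin 2) (Fin 2) ℂ} (hX : X ≠ 0) (hd : X.det = 0) :
    ∃ e f : Fin 2 → ℂ, e ≠ 0 ∧ f ≠ 0 ∧ ∀ i j, X i j = e i * f j := by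
  rw [Matrix.det_fin_two] at hd
  suffices h : ∃ e f : Fin 2 → ℂ, ∀ i j, X i j = e i * f j by
    obtain ⟨e, f, h⟩ := h
    refine ⟨e, f, ?_, ?_, h⟩
    · rintro rfl
      exact hX (by ext i j; simp [h])
    · rintro rfl
      exact hX (by ext i j; simp [h])
  by_cases h0 : X 0 0 = 0
  · rcases mul_eq_zero.1 (show X 0 1 * X 1 0 = 0 by linear_combination X 1 1 * h0 - hd) with h | h
    · refine ⟨![0, 1], ![X 1 0, X 1 1], fun i j => ?_⟩
      fin_cases i <;> fin_cases j <;> simp [h0, h]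
    · refine ⟨![X 0 1, X 1 1], ![0, 1], fun i j => ?_⟩
      fin_cases i <;> fin_cases j <;> simp [h0, h]
  · refine ⟨![1, X 1 0 / X 0 0], ![X 0 0, X 0 1], fun i j => ?_⟩
    fin_cases i <;> fin_cases j <;> simp <;> field_simp
    linear_combination hd

theorem h14_left_eq_zero {q : Tensor} {e f : Fin 2 → ℂ} (hf : f ≠ 0)
    (h : ∀ w z, ev q e f w z = 0) (z : Fin 2 → ℂ) : h14 q e z = 0 := by
  have h0 := h ![1, 0] z
  have h1 := h ![0, 1] z
  rw [ev_apply₂] at h0 h1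
  by_contra hne
  apply hf
  ext k
  fin_cases k
  · refine (mul_eq_zero.1 (?_ : f 0 * h14 q e z = 0)).resolve_right hne
    simp only [h14, det22]
    linear_combination ev q e ![0, 1] ![1, 0] z * h1 - ev q e ![0, 1] ![0, 1] z * h0
  · refine (mul_eq_zero.1 (?_ : f 1 * h14 q e z = 0)).resolve_right hne
    simp only [h14, det22]
    linear_combination ev q e ![1, 0] ![0, 1] z * h0 - ev q e ![1, 0] ![1, 0] z * h1

theorem h14_right_eq_zero {q : Tensor} {g h : Fin 2 → ℂ} (hg : g ≠ 0)
    (hz : ∀ u v, ev q u v g h = 0) (u : Fin 2 → ℂ) : h14 q u h = 0 := by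
  have h0 := hz u ![1, 0]
  have h1 := hz u ![0, 1]
  rw [ev_apply₃] at h0 h1
  by_contra hne
  apply hg
  ext k
  fin_cases k
  · refine (mul_eq_zero.1 (?_ : g 0 * h14 q u h = 0)).resolve_right hne
    simp only [h14, det22]
    linear_combination ev q u ![1, 0] ![0, 1] h * h1 - ev q u ![0, 1] ![0, 1] h * h0
  · refine (mul_eq_zero.1 (?_ : g 1 * h14 q u h = 0)).resolve_right hne
    simp only [h14, det22]
    linear_combination ev q u ![0, 1] ![1, 0] h * h0 - ev q u ![1, 0] ![1, 0] h * h1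

theorem IsPair.classified_or {q : Tensor} (hq : TypeQ q) {X Y : Matrix (Fin 2) (Fin 2) ℂ}
    {σ σ' : ℂ} (h : IsPair q X Y σ σ') (hX : X ≠ 0) (hY : Y ≠ 0) :
    Classified q ∨ X.det ≠ 0 ∧ Y.det ≠ 0 := by
  obtain ⟨h₁, h₂⟩ := h
  simp only [Fin.forall_fin_two, kap] at h₁ h₂
  simp at h₁ h₂
  obtain ⟨⟨p00, p01⟩, p10, p11⟩ := h₁
  obtain ⟨⟨s00, s01⟩, s10, s11⟩ := h₂
  have hσ : σ * Y.det = σ' * X.det := by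
    rw [Matrix.det_fin_two, Matrix.det_fin_two]
    linear_combination (X 0 0 * s00 + X 0 1 * s01 + X 1 0 * s10 + X 1 1 * s11
      - Y 0 0 * p00 - Y 0 1 * p01 - Y 1 0 * p10 - Y 1 1 * p11) / 2
  have hX' : X.det = 0 → ∃ e f : Fin 2 → ℂ, e ≠ 0 ∧ f ≠ 0 ∧ (∀ i j, X i j = e i * f j) ∧
      ∀ w z, ev q e f w z = σ * (Y 1 1 * (w 0 * z 0) - Y 1 0 * (w 0 * z 1) - Y 0 1 * (w 1 * z 0)
        + Y 0 0 * (w 1 * z 1)) := by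
    intro hd
    obtain ⟨e, f, he, hf, hef⟩ := exists_vecMulVec hX hd
    refine ⟨e, f, he, hf, hef, fun w z => ?_⟩
    simp only [hef] at p00 p01 p10 p11
    simp only [ev, Fin.sum_univ_two]
    linear_combination w 0 * z 0 * p00 + w 0 * z 1 * p01 + w 1 * z 0 * p10 + w 1 * z 1 * p11
  have hY' : Y.det = 0 → ∃ g h : Fin 2 → ℂ, g ≠ 0 ∧ h ≠ 0 ∧ (∀ i j, Y i j = g i * h j) ∧
      ∀ u v, ev q u v g h = σ' * (X 1 1 * (u 0 * v 0) - X 1 0 * (u 0 * v 1)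
        - X 0 1 * (u 1 * v 0) + X 0 0 * (u 1 * v 1)) := by
    intro hd
    obtain ⟨g, h, hg, hh, hgh⟩ := exists_vecMulVec hY hd
    refine ⟨g, h, hg, hh, hgh, fun u v => ?_⟩
    simp only [hgh] at s00 s01 s10 s11
    simp only [ev, Fin.sum_univ_two]
    linear_combination u 0 * v 0 * s00 + u 0 * v 1 * s01 + u 1 * v 0 * s10 + u 1 * v 1 * s11
  by_cases dX : X.det = 0 <;> by_cases dY : Y.det = 0
  · obtain ⟨e, f, he, hf, hef, hev⟩ := hX' dX
    obtain ⟨g, h, hg, hh, hgh, hev'⟩ := hY' dY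
    refine Or.inl (classified_of_decomposable hq he hf hg hh (σ := σ) (σ' := σ')
      (fun w z => ?_) (fun u v => ?_))
    · rw [hev]; simp only [hgh]; ring
    · rw [hev']; simp only [hef]; ring
  · obtain ⟨e, f, he, hf, -, hev⟩ := hX' dX
    have : σ = 0 := by simpa [dX, dY] using hσ
    obtain ⟨z, hz⟩ := hq.n14.1 e he
    exact absurd (h14_left_eq_zero hf (fun w z => by rw [hev, this, zero_mul]) z) hz
  · obtain ⟨g, h, hg, hh, -, hev⟩ := hY' dY
    have : σ' = 0 := by simpa [dX, dY] using hσ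
    obtain ⟨u, hu⟩ := hq.n14.2 h hh
    exact absurd (h14_right_eq_zero hg (fun w z => by rw [hev, this, zero_mul]) u) hu
  · exact Or.inr ⟨dX, dY⟩

/-- Existence of singular vectors for a bilinear form with respect to a nondegenerate one. -/
theorem exists_singular_vectors {ι : Type} [Fintype ι] [DecidableEq ι] [Nonempty ι]
    (M K : Matrix ι ι ℂ) (hK : K.det ≠ 0) :
    ∃ (x y : ι → ℂ) (σ σ' : ℂ), x ≠ 0 ∧ y ≠ 0 ∧ M.transpose.mulVec x = σ • K.mulVec y ∧
      M.mulVec y = σ' • K.mulVec x := by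
  by_cases hM : M.det = 0
  · obtain ⟨y, hy, hy'⟩ := Matrix.exists_mulVec_eq_zero_iff.2 hM
    obtain ⟨x, hx, hx'⟩ := Matrix.exists_mulVec_eq_zero_iff.2 ((Matrix.det_transpose M).trans hM)
    exact ⟨x, y, 0, 0, hx, hy, by simp [hx'], by simp [hy']⟩
  · obtain ⟨c, hc⟩ := Module.End.exists_eigenvalue
      (Matrix.toLin' (K⁻¹ * M * K⁻¹ * M.transpose))
    obtain ⟨x, hx⟩ := hc.exists_hasEigenvector
    have hK' : K * K⁻¹ = 1 := Matrix.mul_nonsing_inv _ (isUnit_iff_ne_zero.2 hK)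
    have hx1 : (K⁻¹ * M * K⁻¹ * M.transpose).mulVec x = c • x := by
      simpa only [Matrix.toLin'_apply] using hx.apply_eq_smul
    have e1 : K.mulVec (K⁻¹.mulVec (M.transpose.mulVec x)) = M.transpose.mulVec x := by
      rw [Matrix.mulVec_mulVec, hK', Matrix.one_mulVec]
    refine ⟨x, K⁻¹.mulVec (M.transpose.mulVec x), 1, c, hx.2, fun h0 => hx.2 ?_, ?_, ?_⟩
    · rw [h0, Matrix.mulVec_zero] at e1
      exact Matrix.eq_zero_of_mulVec_eq_zero (by rwa [Matrix.det_transpose]) e1.symm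
    · rw [e1, one_smul]
    · rw [← Matrix.mulVec_smul, ← hx1]
      simp only [Matrix.mulVec_mulVec, ← Matrix.mul_assoc, hK', Matrix.one_mul]

theorem exists_isPair (q : Tensor) :
    ∃ X Y σ σ', X ≠ 0 ∧ Y ≠ 0 ∧ IsPair q X Y σ σ' := by
  let ε : Matrix (Fin 2) (Fin 2) ℂ := !![0, 1; -1, 0]
  obtain ⟨x, y, σ, σ', hx, hy, h₁, h₂⟩ := exists_singular_vectors
    (Matrix.of fun a b : Fin 2 × Fin 2 => q a.1 a.2 b.1 b.2) (Matrix.kroneckerMap (· * ·) ε ε)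
    (by
      rw [Matrix.det_kronecker]
      simp [ε, Matrix.det_fin_two])
  refine ⟨Matrix.of fun i j => x (i, j), Matrix.of fun i j => y (i, j), σ, σ', fun h => hx ?_,
    fun h => hy ?_, fun k l => ?_, fun i j => ?_⟩
  · ext a
    exact congrFun (congrFun h a.1) a.2
  · ext a
    exact congrFun (congrFun h a.1) a.2
  · have := congrFun h₁ (k, l)
    fin_cases k <;> fin_cases l <;>
      simp [Matrix.mulVec, dotProduct, Fintype.sum_prod_type, Fin.sum_univ_two, ε, kap]
        at this ⊢ <;>
      linear_combination this
  · have := congrFun h₂ (i, j)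
    fin_cases i <;> fin_cases j <;>
      simp [Matrix.mulVec, dotProduct, Fintype.sum_prod_type, Fin.sum_univ_two, ε, kap]
        at this ⊢ <;>
      linear_combination this

/-- Invariance, up to sign, of the antisymmetric tensor under `q`. -/
structure IsHalfSymm (q : Tensor) : Prop where
  e₁ : q 0 1 0 0 = q 1 0 0 0
  e₂ : q 0 1 1 1 = q 1 0 1 1
  e₃ : q 0 0 0 1 = q 0 0 1 0
  e₄ : q 1 1 0 1 = q 1 1 1 0
  e₅ : q 0 1 0 1 = q 1 0 1 0
  e₆ : q 0 1 1 0 = q 1 0 0 1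

theorem IsPair.isHalfSymm_act {q : Tensor} {X Y : Matrix (Fin 2) (Fin 2) ℂ} {σ σ' : ℂ}
    (h : IsPair q X Y σ σ') :
    IsHalfSymm (act q !![X 0 1, -X 0 0; X 1 1, -X 1 0] 1 !![Y 0 1, -Y 0 0; Y 1 1, -Y 1 0] 1) := by
  obtain ⟨h₁, h₂⟩ := h
  simp only [Fin.forall_fin_two, kap] at h₁ h₂
  simp at h₁ h₂
  obtain ⟨⟨p00, p01⟩, p10, p11⟩ := h₁
  obtain ⟨⟨s00, s01⟩, s10, s11⟩ := h₂
  constructor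
  · simp [act, ev, Fin.sum_univ_two]
    linear_combination Y 0 1 * p00 + Y 1 1 * p10
  · simp [act, ev, Fin.sum_univ_two]
    linear_combination -Y 0 0 * p01 - Y 1 0 * p11
  · simp [act, ev, Fin.sum_univ_two]
    linear_combination X 0 1 * s00 + X 1 1 * s10
  · simp [act, ev, Fin.sum_univ_two]
    linear_combination -X 0 0 * s01 - X 1 0 * s11
  · simp [act, ev, Fin.sum_univ_two]
    linear_combination (Y 0 1 * p01 + Y 1 1 * p11 - Y 0 0 * p00 - Y 1 0 * p10
      + (X 0 1 * s01 + X 1 1 * s11 - X 0 0 * s00 - X 1 0 * s10)) / 2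
  · simp [act, ev, Fin.sum_univ_two]
    linear_combination (Y 0 1 * p01 + Y 1 1 * p11 - Y 0 0 * p00 - Y 1 0 * p10
      - (X 0 1 * s01 + X 1 1 * s11 - X 0 0 * s00 - X 1 0 * s10)) / 2

theorem IsHalfSymm.act {q : Tensor} (hq : IsHalfSymm q) (g h : Matrix (Fin 2) (Fin 2) ℂ) :
    IsHalfSymm (act q g g h h) := by
  obtain ⟨e₁, e₂, e₃, e₄, e₅, e₆⟩ := hq
  constructor <;> simp only [_root_.act, ev, Fin.sum_univ_two, e₁, e₂, e₃, e₄, e₅, e₆] <;> ring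

theorem IsHalfSymm.exists_isPair {q : Tensor} (hq : IsHalfSymm q) :
    ∃ X Y σ σ', X ≠ 0 ∧ Y ≠ 0 ∧ X 0 1 = X 1 0 ∧ Y 0 1 = Y 1 0 ∧ IsPair q X Y σ σ' := by
  obtain ⟨e₁, e₂, e₃, e₄, e₅, e₆⟩ := hq
  obtain ⟨x, y, σ, σ', hx, hy, h₁, h₂⟩ := exists_singular_vectors
    !![q 0 0 0 0, q 0 0 0 1 + q 0 0 1 0, q 0 0 1 1;
      q 0 1 0 0 + q 1 0 0 0, q 0 1 0 1 + q 0 1 1 0 + q 1 0 0 1 + q 1 0 1 0,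
        q 0 1 1 1 + q 1 0 1 1;
      q 1 1 0 0, q 1 1 0 1 + q 1 1 1 0, q 1 1 1 1]
    !![0, 0, 1; 0, -2, 0; 1, 0, 0] (by simp [Matrix.det_fin_three])
  have a0 := congrFun h₁ 0
  have a1 := congrFun h₁ 1
  have a2 := congrFun h₁ 2
  have b0 := congrFun h₂ 0
  have b1 := congrFun h₂ 1
  have b2 := congrFun h₂ 2
  simp [Matrix.mulVec, dotProduct, Fin.sum_univ_three] at a0 a1 a2 b0 b1 b2
  refine ⟨!![x 0, x 1; x 1, x 2], !![y 0, y 1; y 1, y 2], σ, σ', fun h => hx ?_,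
    fun h => hy ?_, rfl, rfl, fun k l => ?_, fun i j => ?_⟩
  · ext a
    fin_cases a
    exacts [congrFun (congrFun h 0) 0, congrFun (congrFun h 0) 1, congrFun (congrFun h 1) 1]
  · ext a
    fin_cases a
    exacts [congrFun (congrFun h 0) 0, congrFun (congrFun h 0) 1, congrFun (congrFun h 1) 1]
  · fin_cases k <;> fin_cases l <;> simp [kap]
    · linear_combination a0
    · linear_combination a1 / 2 + (x 0 * e₃ + x 1 * (e₅ - e₆) + x 2 * e₄) / 2
    · linear_combination a1 / 2 - (x 0 * e₃ + x 1 * (e₅ - e₆) + x 2 * e₄) / 2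
    · linear_combination a2
  · fin_cases i <;> fin_cases j <;> simp [kap]
    · linear_combination b0
    · linear_combination b1 / 2 + (y 0 * e₁ + y 1 * (e₅ + e₆) + y 2 * e₂) / 2
    · linear_combination b1 / 2 - (y 0 * e₁ + y 1 * (e₅ + e₆) + y 2 * e₂) / 2
    · linear_combination b2

theorem exists_congr_antidiag {X : Matrix (Fin 2) (Fin 2) ℂ} (hX : X 0 1 = X 1 0)
    (hd : X.det ≠ 0) : ∃ g : Matrix (Fin 2) (Fin 2) ℂ, g.det ≠ 0 ∧
      X 0 0 = 2 * g 0 0 * g 0 1 ∧ X 1 0 = g 0 0 * g 1 1 + g 1 0 * g 0 1 ∧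
      X 1 1 = 2 * g 1 0 * g 1 1 := by
  rw [Matrix.det_fin_two, hX] at hd
  suffices h : ∃ g : Matrix (Fin 2) (Fin 2) ℂ,
      X 0 0 = 2 * g 0 0 * g 0 1 ∧ X 1 0 = g 0 0 * g 1 1 + g 1 0 * g 0 1 ∧
      X 1 1 = 2 * g 1 0 * g 1 1 by
    obtain ⟨g, h1, h2, h3⟩ := h
    refine ⟨g, fun h0 => hd ?_, h1, h2, h3⟩
    rw [Matrix.det_fin_two] at h0
    rw [h1, h2, h3]
    linear_combination (-(g 0 0 * g 1 1 - g 0 1 * g 1 0)) * h0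
  by_cases h0 : X 0 0 = 0
  · refine ⟨!![0, X 1 0; 1, X 1 1 / 2], ?_, ?_, ?_⟩ <;> simp [h0]
    ring
  · obtain ⟨s, hs⟩ := exists_sqrt (X 1 0 ^ 2 - X 0 0 * X 1 1)
    refine ⟨!![1, X 0 0 / 2; (X 1 0 + s) / X 0 0, (X 1 0 - s) / 2], ?_, ?_, ?_⟩ <;> simp
    · ring
    · field_simp
      ring
    · field_simp
      linear_combination hs

theorem IsHalfSymm.eq_evenForm {q : Tensor} (hq : IsHalfSymm q)
    (h₁ : q 0 1 0 0 + q 1 0 0 0 = 0) (h₂ : q 0 1 1 1 + q 1 0 1 1 = 0)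
    (h₃ : q 0 0 0 1 + q 0 0 1 0 = 0) (h₄ : q 1 1 0 1 + q 1 1 1 0 = 0) :
    q = evenForm (q 1 1 1 1) (q 0 0 0 0) (q 1 1 0 0) (q 0 0 1 1) (q 1 0 0 1) (q 1 0 1 0) := by
  obtain ⟨e₁, e₂, e₃, e₄, e₅, e₆⟩ := hq
  have f₁ : q 1 0 0 0 = 0 := by linear_combination (h₁ - e₁) / 2
  have f₂ : q 1 0 1 1 = 0 := by linear_combination (h₂ - e₂) / 2
  have f₃ : q 0 0 1 0 = 0 := by linear_combination (h₃ - e₃) / 2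
  have f₄ : q 1 1 1 0 = 0 := by linear_combination (h₄ - e₄) / 2
  rw [f₁] at e₁
  rw [f₂] at e₂
  rw [f₃] at e₃
  rw [f₄] at e₄
  refine tensor_ext fun i j k l => ?_
  fin_cases i <;> fin_cases j <;> fin_cases k <;> fin_cases l <;> simp [evenForm, *]

theorem IsHalfSymm.classified {q : Tensor} (hs : IsHalfSymm q) (hq : TypeQ q) :
    Classified q := by
  obtain ⟨X, Y, σ, σ', hX, hY, sX, sY, hp⟩ := hs.exists_isPair
  rcases hp.classified_or hq hX hY with hc | ⟨dX, dY⟩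
  · exact hc
  obtain ⟨g, dg, g1, g2, g3⟩ := exists_congr_antidiag sX dX
  obtain ⟨h, dh, h1, h2, h3⟩ := exists_congr_antidiag sY dY
  obtain ⟨p, s⟩ := hp
  simp only [Fin.forall_fin_two, kap, sX, sY, g1, g2, g3, h1, h2, h3] at p s
  simp at p s
  obtain ⟨⟨p00, p01⟩, p10, p11⟩ := p
  obtain ⟨⟨s00, s01⟩, s10, s11⟩ := s
  refine Classified.of_act (g₁ := g) (g₂ := g) (g₃ := h) (g₄ := h) ?_ dg dg dh dh
  have hq' := hq.act dg dg dh dh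
  have z0 : _root_.act q g g h h 0 1 0 0 + _root_.act q g g h h 1 0 0 0 = 0 := by
    simp only [_root_.act, ev, Fin.sum_univ_two]
    linear_combination h 0 0 * h 0 0 * p00 + h 0 0 * h 1 0 * p01 + h 1 0 * h 0 0 * p10
      + h 1 0 * h 1 0 * p11
  have z1 : _root_.act q g g h h 0 1 1 1 + _root_.act q g g h h 1 0 1 1 = 0 := by
    simp only [_root_.act, ev, Fin.sum_univ_two]
    linear_combination h 0 1 * h 0 1 * p00 + h 0 1 * h 1 1 * p01 + h 1 1 * h 0 1 * p10
      + h 1 1 * h 1 1 * p11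
  have z2 : _root_.act q g g h h 0 0 0 1 + _root_.act q g g h h 0 0 1 0 = 0 := by
    simp only [_root_.act, ev, Fin.sum_univ_two]
    linear_combination g 0 0 * g 0 0 * s00 + g 0 0 * g 1 0 * s01 + g 1 0 * g 0 0 * s10
      + g 1 0 * g 1 0 * s11
  have z3 : _root_.act q g g h h 1 1 0 1 + _root_.act q g g h h 1 1 1 0 = 0 := by
    simp only [_root_.act, ev, Fin.sum_univ_two]
    linear_combination g 0 1 * g 0 1 * s00 + g 0 1 * g 1 1 * s01 + g 1 1 * g 0 1 * s10
      + g 1 1 * g 1 1 * s11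
  rw [(hs.act g h).eq_evenForm z0 z1 z2 z3] at hq' ⊢
  exact classified_evenForm hq'

theorem TypeQ.classified {q : Tensor} (hq : TypeQ q) : Classified q := by
  obtain ⟨X, Y, σ, σ', hX, hY, hp⟩ := exists_isPair q
  rcases hp.classified_or hq hX hY with hc | ⟨dX, dY⟩
  · exact hc
  have d : ∀ {X : Matrix (Fin 2) (Fin 2) ℂ}, X.det ≠ 0 →
      (!![X 0 1, -X 0 0; X 1 1, -X 1 0] : Matrix (Fin 2) (Fin 2) ℂ).det ≠ 0 := by
    intro X hX h0
    rw [Matrix.det_fin_two] at hX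
    apply hX
    simp [Matrix.det_fin_two] at h0
    linear_combination h0
  have d1 : (1 : Matrix (Fin 2) (Fin 2) ℂ).det ≠ 0 := by simp
  exact Classified.of_act (hp.isHalfSymm_act.classified (hq.act (d dX) d1 (d dY) d1))
    (d dX) d1 (d dY) d1

/-- Classification of affine-linear equations of type Q: every irreducible affine-linear
`Q(x₁,x₂,x₃,x₄)` (variables indexed `0,1,2,3`) all of whose accompanying biquadratics
`h^{12} = dd 2 3 Q`, `h^{23} = dd 0 3 Q`, `h^{34} = dd 0 1 Q`, `h^{14} = dd 1 2 Q` are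
non-degenerate is equivalent, modulo Möbius transformations and a nonzero constant factor,
to one of the canonical forms (Q4), (Q3), (Q2), (Q1). -/
theorem statement19 (Q : MvPolynomial (Fin 4) ℂ)
    (haff : ∀ i, Q.degreeOf i ≤ 1) (hirr : Irreducible Q)
    (hpd : ∀ i, pderiv i Q ≠ 0)
    (h12 : Nondeg (dd 2 3 Q) 0 1) (h23 : Nondeg (dd 0 3 Q) 1 2)
    (h34 : Nondeg (dd 0 1 Q) 2 3) (h14 : Nondeg (dd 1 2 Q) 0 3) :
    ∃ (a b c d : Fin 4 → ℂ) (μ : ℂ),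
      (∀ i, a i * d i - b i * c i ≠ 0) ∧ μ ≠ 0 ∧
      ((∃ k α β A B : ℂ,
          A ^ 2 = (α ^ 2 - 1) * (k ^ 2 * α ^ 2 - 1) ∧
          B ^ 2 = (β ^ 2 - 1) * (k ^ 2 * β ^ 2 - 1) ∧
          k ^ 2 * α ^ 2 * β ^ 2 ≠ 1 ∧
          C μ * mob Q a b c d =
            C (α * β * ((α * B + β * A) / (k ^ 2 * α ^ 2 * β ^ 2 - 1))) *
                (C (k ^ 2) * (X 0 * X 1 * X 2 * X 3) + 1)
              + C α * (X 0 * X 1 + X 2 * X 3)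
              + C β * (X 0 * X 3 + X 1 * X 2)
              + C ((α * B + β * A) / (k ^ 2 * α ^ 2 * β ^ 2 - 1)) *
                  (X 0 * X 2 + X 1 * X 3)) ∨
       (∃ α β δ : ℂ, α ≠ 0 ∧ β ≠ 0 ∧
          C μ * mob Q a b c d =
            C (α - α⁻¹) * (X 0 * X 1 + X 2 * X 3)
              + C (β - β⁻¹) * (X 0 * X 3 + X 1 * X 2)
              - C (α * β - α⁻¹ * β⁻¹) * (X 0 * X 2 + X 1 * X 3)
              + C (δ / 4 * (α - α⁻¹) * (β - β⁻¹) * (α * β - α⁻¹ * β⁻¹))) ∨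
       (∃ α β : ℂ,
          C μ * mob Q a b c d =
            C α * ((X 0 - X 3) * (X 1 - X 2)) + C β * ((X 0 - X 1) * (X 3 - X 2))
              - C (α * β * (α + β)) * (X 0 + X 1 + X 2 + X 3)
              + C (α * β * (α + β) * (α ^ 2 + α * β + β ^ 2))) ∨
       (∃ α β δ : ℂ,
          C μ * mob Q a b c d =
            C α * ((X 0 - X 3) * (X 1 - X 2)) + C β * ((X 0 - X 1) * (X 3 - X 2))
              - C (δ * α * β * (α + β)))) := by
  rw [eq_toPoly_tens Q haff] at h12 h23 h34 h14
  have hq : TypeQ (tens Q) :=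
    ⟨noFactor_h12 h12, noFactor_h23 h23, noFactor_h34 h34, noFactor_h14 h14⟩
  obtain ⟨g₁, g₂, g₃, g₄, μ, d₁, d₂, d₃, d₄, hμ, hc⟩ := hq.classified
  rw [Matrix.det_fin_two] at d₁ d₂ d₃ d₄
  refine ⟨fun i => ![g₁, g₂, g₃, g₄] i 1 1, fun i => ![g₁, g₂, g₃, g₄] i 1 0,
    fun i => ![g₁, g₂, g₃, g₄] i 0 1, fun i => ![g₁, g₂, g₃, g₄] i 0 0, μ, fun i => ?_, hμ, ?_⟩
  · have e : ∀ g : Matrix (Fin 2) (Fin 2) ℂ, g 0 0 * g 1 1 - g 0 1 * g 1 0 ≠ 0 →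
        g 1 1 * g 0 0 - g 1 0 * g 0 1 ≠ 0 := fun g hg h => hg (by linear_combination h)
    fin_cases i
    exacts [e g₁ d₁, e g₂ d₂, e g₃ d₃, e g₄ d₄]
  have hmul : ∀ (g : Matrix (Fin 2) (Fin 2) ℂ) (x : ℂ),
      g.mulVec ![1, x] = ![g 0 1 * x + g 0 0, g 1 1 * x + g 1 0] := by
    intro g x
    ext k
    fin_cases k <;> simp [Matrix.mulVec, dotProduct, Fin.sum_univ_two] <;> ring
  simp only [IsCanonical, hmul] at hc
  rcases hc with ⟨k, α, β, A, B, hA, hB, hk, h⟩ | ⟨α, β, δ, hα, hβ, h⟩ | ⟨α, β, h⟩ | ⟨α, β, δ, h⟩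
  · refine Or.inl ⟨k, α, β, A, B, hA, hB, hk, MvPolynomial.funext fun x => ?_⟩
    rw [map_mul, eval_C, eval_mob]
    refine (h (x 0) (x 1) (x 2) (x 3)).trans ?_
    simp only [map_add, map_mul, map_one, eval_C, eval_X]
  · refine Or.inr (Or.inl ⟨α, β, δ, hα, hβ, MvPolynomial.funext fun x => ?_⟩)
    rw [map_mul, eval_C, eval_mob]
    refine (h (x 0) (x 1) (x 2) (x 3)).trans ?_
    simp only [map_add, map_sub, map_mul, eval_C, eval_X]
  · refine Or.inr (Or.inr (Or.inl ⟨α, β, MvPolynomial.funext fun x => ?_⟩))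
    rw [map_mul, eval_C, eval_mob]
    refine (h (x 0) (x 1) (x 2) (x 3)).trans ?_
    simp only [map_add, map_sub, map_mul, eval_C, eval_X]
  · refine Or.inr (Or.inr (Or.inr ⟨α, β, δ, MvPolynomial.funext fun x => ?_⟩))
    rw [map_mul, eval_C, eval_mob]
    refine (h (x 0) (x 1) (x 2) (x 3)).trans ?_
    simp only [map_add, map_sub, map_mul, eval_C, eval_X]
end
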